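/- arXiv:1910.01482 — 4 statements merged into one kernel-verified Lean document; each statement's English description precedes it below -/
import Mathlib

section
/- Fix λ > 0, Ω > 0, p > 0. Define F : ℓ¹(ℤ, ℝ) × (0, ∞) → ℓ¹(ℤ, ℝ) by [F(U,h)]_n = ( λ|U_n|^{2p} − Ω + (h²/4)·Σ_{k=n}^{∞} U_k⁴ )·U_n + (1/h²)(U_{n+1} − 2U_n + U_{n−1}). Then F is well defined (maps ℓ¹(ℤ, ℝ) × (0,∞) into ℓ¹(ℤ, ℝ)) and is continuously Fréchet differentiable (C¹) on ℓ¹(ℤ, ℝ) × (0, ∞). -/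
open Topology Filter in
theorem css_unif (g : ℝ → ℝ) (hg : Continuous g) (R ε : ℝ) (hε : 0 < ε) :
    ∃ δ > 0, ∀ x y : ℝ, |x| ≤ R → |y - x| < δ → |g y - g x| ≤ ε := by
  have h := (isCompact_Icc (a := -R) (b := R)).uniformContinuousAt_of_continuousAt g
    (fun x _ => hg.continuousAt) (Metric.dist_mem_uniformity hε)
  obtain ⟨δ, hδ, H⟩ := Metric.mem_uniformity_dist.1 h
  refine ⟨δ, hδ, fun x y hx hxy => ?_⟩
  have := @H x y (by rw [dist_comm, Real.dist_eq]; exact hxy) (abs_le.1 hx)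
  have h2 : dist (g x) (g y) < ε := this
  rw [dist_comm, Real.dist_eq] at h2
  exact h2.le

abbrev CssE := lp (fun _ : ℤ => ℝ) 1

theorem css_norm (U : CssE) : ‖U‖ = ∑' n, |U n| := by
  rw [lp.norm_eq_tsum_rpow (by simp)]; simp

theorem css_summable (U : CssE) : Summable (fun n => |U n|) := by
  have := (memℓp_gen_iff (p := 1) (by simp)).1 (lp.memℓp U)
  simpa using this

theorem css_mk (a : ℤ → ℝ) (h : Summable (fun n => |a n|)) : ∃ W : CssE, ∀ n, W n = a n := by
  refine ⟨⟨a, (memℓp_gen_iff (p := 1) (by simp)).2 (by simpa using h)⟩, fun n => rfl⟩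

theorem css_ext {U V : CssE} (h : ∀ n, U n = V n) : U = V := lp.ext (funext h)

theorem css_le (U : CssE) (n : ℤ) : |U n| ≤ ‖U‖ := by
  simpa using lp.norm_apply_le_norm (p := 1) (by simp) U n

theorem css_bound (W V : CssE) (C : ℝ) (h : ∀ n, |W n| ≤ C * |V n|) : ‖W‖ ≤ C * ‖V‖ := by
  rw [css_norm, css_norm, ← tsum_mul_left]
  exact (css_summable W).tsum_le_tsum h ((css_summable V).mul_left C)

theorem css_mk' (a : ℤ → ℝ) (V : CssE) (C : ℝ) (h : ∀ n, |a n| ≤ C * |V n|) :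
    ∃ W : CssE, ∀ n, W n = a n :=
  css_mk a (Summable.of_nonneg_of_le (fun _ => abs_nonneg _) h ((css_summable V).mul_left C))

theorem css_mul (a : ℤ → ℝ) (C : ℝ) (hC : 0 ≤ C) (h : ∀ n, |a n| ≤ C) :
    ∃ L : CssE →L[ℝ] CssE, ∀ V n, L V n = a n * V n := by
  have h1 : ∀ (V : CssE) n, |a n * V n| ≤ C * |V n| := fun V n => by
    rw [abs_mul]; exact mul_le_mul_of_nonneg_right (h n) (abs_nonneg _)
  choose f hf using fun V : CssE => css_mk' (fun n => a n * V n) V C (h1 V)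
  let l : CssE →ₗ[ℝ] CssE :=
    { toFun := f
      map_add' := fun U V => css_ext fun n => by simp [hf]; ring
      map_smul' := fun c V => css_ext fun n => by simp [hf]; ring }
  refine ⟨l.mkContinuous C fun V => css_bound _ _ _ fun n => ?_, fun V n => hf V n⟩
  change |f V n| ≤ _
  rw [hf]; exact h1 V n

theorem css_nem (g g' : ℝ → ℝ) (hg : ∀ x, HasDerivAt g (g' x) x) (hc : Continuous g')
    (h0 : g 0 = 0) :
    ∃ N : CssE → CssE, (∀ U n, N U n = g (U n)) ∧ ContDiff ℝ 1 N := by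
  have hb : ∀ R, ∃ C, 0 ≤ C ∧ ∀ x, |x| ≤ R → |g' x| ≤ C := by
    intro R
    obtain ⟨C, hC⟩ := (isCompact_Icc (a := -R) (b := R)).exists_bound_of_continuousOn
      hc.continuousOn
    exact ⟨max C 0, le_max_right _ _, fun x hx => (hC x (abs_le.1 hx)).trans (le_max_left _ _)⟩
  have hgb : ∀ U : CssE, ∃ C, ∀ n, |g (U n)| ≤ C * |U n| := by
    intro U
    obtain ⟨C, _, hC⟩ := hb ‖U‖
    refine ⟨C, fun n => ?_⟩
    have := Convex.norm_image_sub_le_of_norm_hasDerivWithin_le (s := Set.Icc (-‖U‖) ‖U‖)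
      (fun x _ => (hg x).hasDerivWithinAt) (fun x hx => hC x (abs_le.2 hx))
      (convex_Icc _ _) (x := 0) (y := U n) (by simp) (abs_le.1 (css_le U n))
    simpa [h0] using this
  have hN : ∀ U : CssE, ∃ W : CssE, ∀ n, W n = g (U n) := fun U => by
    obtain ⟨C, hC⟩ := hgb U
    exact css_mk' _ U C hC
  choose N hN using hN
  have hD : ∀ U : CssE, ∃ L : CssE →L[ℝ] CssE, ∀ V n, L V n = g' (U n) * V n := fun U => by
    obtain ⟨C, h0, hC⟩ := hb ‖U‖
    exact css_mul _ C h0 fun n => hC _ (css_le U n)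
  choose D hD using hD
  refine ⟨N, hN, contDiff_one_iff_hasFDerivAt.2 ⟨D, ?_, fun U => ?_⟩⟩
  · refine continuous_iff_continuousAt.2 fun U => Metric.continuousAt_iff.2 fun ε hε => ?_
    obtain ⟨δ, hδ, H⟩ := css_unif g' hc ‖U‖ (ε / 2) (half_pos hε)
    refine ⟨δ, hδ, fun {W} hW => ?_⟩
    rw [dist_eq_norm] at hW ⊢
    refine lt_of_le_of_lt ?_ (half_lt_self hε)
    refine ContinuousLinearMap.opNorm_le_bound _ (half_pos hε).le fun V => ?_
    refine css_bound _ _ _ fun n => ?_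
    have : ((D W - D U) V : CssE) n = (g' (W n) - g' (U n)) * V n := by
      simp [hD]; ring
    rw [this, abs_mul]
    refine mul_le_mul_of_nonneg_right (H _ _ (css_le U n) ?_) (abs_nonneg _)
    exact lt_of_le_of_lt (by simpa using css_le (W - U) n) hW
  · rw [hasFDerivAt_iff_isLittleO_nhds_zero, Asymptotics.isLittleO_iff]
    intro ε hε
    obtain ⟨δ, hδ, H⟩ := css_unif g' hc ‖U‖ ε hε
    filter_upwards [Metric.ball_mem_nhds (0 : CssE) hδ] with V hV
    rw [mem_ball_zero_iff] at hV
    refine css_bound _ _ _ fun n => ?_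
    have hVn : |V n| < δ := (css_le V n).trans_lt hV
    have : (N (U + V) - N U - D U V : CssE) n
        = (g (U n + V n) - g' (U n) * (U n + V n)) - (g (U n) - g' (U n) * U n) := by
      simp [hN, hD]; ring
    rw [this]
    have := Convex.norm_image_sub_le_of_norm_hasDerivWithin_le (s := Metric.ball (U n) δ)
      (f := fun x => g x - g' (U n) * x) (f' := fun x => g' x - g' (U n) * 1) (C := ε)
      (fun x _ => ((hg x).sub ((hasDerivAt_id x).const_mul (g' (U n)))).hasDerivWithinAt)
      (fun x hx => by
        rw [mul_one]
        exact H _ _ (css_le U n) (by simpa [Real.dist_eq] using hx))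
      (convex_ball _ _) (x := U n) (y := U n + V n) (by simpa using hδ)
      (by simpa [Real.dist_eq] using hVn)
    simpa using this

theorem css_g (q : ℝ) (hq : 0 < q) (x : ℝ) :
    HasDerivAt (fun x : ℝ => |x| ^ q * x) ((q + 1) * |x| ^ q) x := by
  have hc : Continuous fun x : ℝ => |x| ^ q :=
    continuous_abs.rpow_const fun _ => Or.inr hq.le
  have key : ∀ y : ℝ, 0 < y → HasDerivAt (fun x : ℝ => |x| ^ q * x) ((q + 1) * |y| ^ q) y := by
    intro y hy
    have h1 := Real.hasDerivAt_rpow_const (x := y) (p := q + 1) (Or.inl hy.ne')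
    rw [abs_of_pos hy]
    rw [add_sub_cancel_right] at h1
    refine h1.congr_of_eventuallyEq ?_
    filter_upwards [lt_mem_nhds hy] with z hz
    rw [abs_of_pos hz, Real.rpow_add_one hz.ne']
  have key2 : ∀ y : ℝ, y ≠ 0 → HasDerivAt (fun x : ℝ => |x| ^ q * x) ((q + 1) * |y| ^ q) y := by
    intro y hy
    rcases lt_or_gt_of_ne hy with h | h
    · have h1 := ((key (-y) (by linarith)).comp y (hasDerivAt_neg y)).neg
      have e1 : (-(fun x : ℝ => |x| ^ q * x) ∘ Neg.neg) = fun x : ℝ => |x| ^ q * x := by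
        funext z; simp
      have e2 : -((q + 1) * |(-y)| ^ q * -1) = (q + 1) * |y| ^ q := by simp
      rw [e1, e2] at h1
      exact h1
    · exact key y h
  by_cases hx : x = 0
  · subst hx
    exact hasDerivAt_of_hasDerivAt_of_ne (g := fun y => (q + 1) * |y| ^ q) key2
      (hc.mul continuous_id).continuousAt (continuous_const.mul hc).continuousAt
  · exact key2 x hx

theorem css_prod : ∃ P : CssE × CssE → CssE, (∀ U V n, P (U, V) n = U n * V n) ∧
    ContDiff ℝ 1 P := by
  have h1 : ∀ (U V : CssE) n, |U n * V n| ≤ ‖U‖ * |V n| := fun U V n => by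
    rw [abs_mul]; exact mul_le_mul_of_nonneg_right (css_le U n) (abs_nonneg _)
  choose f hf using fun U V : CssE => css_mk' (fun n => U n * V n) V ‖U‖ (h1 U V)
  refine ⟨fun x => f x.1 x.2, hf, IsBoundedBilinearMap.contDiff (𝕜 := ℝ) ⟨?_, ?_, ?_, ?_, 1, one_pos, ?_⟩⟩
  · intro a b c; exact css_ext fun n => by simp [hf]; ring
  · intro a b c; exact css_ext fun n => by simp [hf]; ring
  · intro a b c; exact css_ext fun n => by simp [hf]; ring
  · intro a b c; exact css_ext fun n => by simp [hf]; ring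
  · intro U V
    rw [one_mul]
    exact css_bound _ _ _ fun n => by simpa only [hf] using h1 U V n

theorem css_tail_summable (U : CssE) (n : ℤ) :
    Summable fun k : ℤ => if n ≤ k then U k else 0 := by
  refine Summable.of_norm_bounded (css_summable U) fun k => ?_
  split_ifs <;> simp

theorem css_tail_le (U : CssE) (n : ℤ) :
    |∑' k : ℤ, if n ≤ k then U k else 0| ≤ ‖U‖ := by
  rw [css_norm]
  have h : ‖∑' k : ℤ, if n ≤ k then U k else 0‖ ≤ ∑' n, |U n| := by
    refine tsum_of_norm_bounded (css_summable U).hasSum fun k => ?_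
    split_ifs <;> simp
  exact h

theorem css_tail : ∃ P : CssE × CssE → CssE,
    (∀ U V n, P (U, V) n = (∑' k : ℤ, if n ≤ k then U k else 0) * V n) ∧ ContDiff ℝ 1 P := by
  have h1 : ∀ (U V : CssE) n, |(∑' k : ℤ, if n ≤ k then U k else 0) * V n| ≤ ‖U‖ * |V n| :=
    fun U V n => by
      rw [abs_mul]; exact mul_le_mul_of_nonneg_right (css_tail_le U n) (abs_nonneg _)
  choose f hf using fun U V : CssE => css_mk' _ V ‖U‖ (h1 U V)
  have hadd : ∀ (U V : CssE) (n : ℤ), (∑' k : ℤ, if n ≤ k then (U + V) k else 0)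
      = (∑' k : ℤ, if n ≤ k then U k else 0) + ∑' k : ℤ, if n ≤ k then V k else 0 := by
    intro U V n
    rw [← (css_tail_summable U n).tsum_add (css_tail_summable V n)]
    refine tsum_congr fun k => ?_
    split_ifs <;> simp
  have hsmul : ∀ (c : ℝ) (U : CssE) (n : ℤ), (∑' k : ℤ, if n ≤ k then (c • U) k else 0)
      = c * (∑' k : ℤ, if n ≤ k then U k else 0) := by
    intro c U n
    rw [← tsum_mul_left]
    refine tsum_congr fun k => ?_
    split_ifs <;> simp
  refine ⟨fun x => f x.1 x.2, hf, IsBoundedBilinearMap.contDiff (𝕜 := ℝ) ⟨?_, ?_, ?_, ?_, 1, one_pos, ?_⟩⟩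
  · intro a b c; refine css_ext fun n => ?_
    rw [lp.coeFn_add, Pi.add_apply]
    simp only [hf]; rw [hadd]; ring
  · intro a b c; refine css_ext fun n => ?_
    rw [lp.coeFn_smul, Pi.smul_apply]
    simp only [hf]; rw [hsmul, smul_eq_mul]; ring
  · intro a b c; refine css_ext fun n => ?_
    rw [lp.coeFn_add, Pi.add_apply]
    simp only [hf]; rw [lp.coeFn_add, Pi.add_apply]; ring
  · intro a b c; refine css_ext fun n => ?_
    rw [lp.coeFn_smul, Pi.smul_apply]
    simp only [hf]; rw [lp.coeFn_smul, Pi.smul_apply, smul_eq_mul, smul_eq_mul]; ring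
  · intro U V
    rw [one_mul]
    exact css_bound _ _ _ fun n => by simpa only [hf] using h1 U V n

theorem css_shift (m : ℤ) : ∃ L : CssE →L[ℝ] CssE, ∀ V n, L V n = V (n + m) := by
  have h1 : ∀ V : CssE, Summable fun n => |V (n + m)| := fun V =>
    (Equiv.addRight m).summable_iff.2 (css_summable V)
  choose f hf using fun V : CssE => css_mk (fun n => V (n + m)) (h1 V)
  let l : CssE →ₗ[ℝ] CssE :=
    { toFun := f
      map_add' := fun U V => css_ext fun n => by simp [hf]
      map_smul' := fun c V => css_ext fun n => by simp [hf] }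
  refine ⟨l.mkContinuous 1 fun V => ?_, fun V n => hf V n⟩
  change ‖f V‖ ≤ _
  rw [css_norm, css_norm, one_mul]
  simp only [hf]
  exact ((Equiv.addRight m).tsum_eq fun n => |V n|).le


/-- **The stationary vector field is well defined and `C¹` on `ℓ¹(ℤ,ℝ) × (0,∞)`**:
there is a map `F : ℓ¹(ℤ,ℝ) × ℝ → ℓ¹(ℤ,ℝ)` given componentwise (for `h > 0`) by
`[F(U,h)]ₙ = (λ|Uₙ|^{2p} − Ω + (h²/4)Σ_{k≥n} U_k⁴)Uₙ + (1/h²)(U_{n+1} − 2Uₙ + U_{n−1})`,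
which is continuously Fréchet differentiable on `ℓ¹(ℤ,ℝ) × (0,∞)`. -/
theorem stationary_CSS_field_C1
    (lam Ω p : ℝ) (hlam : 0 < lam) (hΩ : 0 < Ω) (hp : 0 < p) :
    ∃ F : lp (fun _ : ℤ => ℝ) 1 × ℝ → lp (fun _ : ℤ => ℝ) 1,
      (∀ (U : lp (fun _ : ℤ => ℝ) 1) (h : ℝ), 0 < h → ∀ n : ℤ,
        F (U, h) n
          = (lam * |U n| ^ (2 * p) - Ω
              + h ^ 2 / 4 * ∑' k : ℤ, (if n ≤ k then (U k) ^ 4 else 0)) * U n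
            + (1 / h ^ 2) * (U (n + 1) - 2 * U n + U (n - 1)))
      ∧ ContDiffOn ℝ 1 F (Set.univ ×ˢ Set.Ioi (0 : ℝ)) := by
  obtain ⟨N, hN, cN⟩ := css_nem (fun x => |x| ^ (2 * p) * x) _
    (css_g (2 * p) (by positivity))
    (continuous_const.mul (continuous_abs.rpow_const fun _ => Or.inr (by positivity))) (by simp)
  obtain ⟨P, hP, cP⟩ := css_prod
  obtain ⟨T, hT, cT⟩ := css_tail
  obtain ⟨S, hS⟩ := css_shift 1
  obtain ⟨S', hS'⟩ := css_shift (-1)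
  refine ⟨fun x => lam • N x.1 - Ω • x.1
    + (x.2 ^ 2 / 4) • T (P (P (x.1, x.1), P (x.1, x.1)), x.1)
    + (1 / x.2 ^ 2) • (S x.1 - (2 : ℝ) • x.1 + S' x.1), ?_, ?_⟩
  · intro U h hh n
    have e : ∀ k, P (P (U, U), P (U, U)) k = U k ^ 4 := fun k => by
      simp only [hP]; ring
    simp only [lp.coeFn_add, lp.coeFn_sub, lp.coeFn_smul, Pi.add_apply, Pi.sub_apply,
      Pi.smul_apply, smul_eq_mul, hN, hT, hS, hS', e]
    rw [← sub_eq_add_neg]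
    ring
  · have c1 : ContDiff ℝ 1 (fun x : CssE × ℝ => x.1) := contDiff_fst
    have c2 : ContDiff ℝ 1 (fun x : CssE × ℝ => x.2) := contDiff_snd
    have cPP := cP.comp (c1.prodMk c1)
    have cM := cT.comp ((cP.comp (cPP.prodMk cPP)).prodMk c1)
    have cNN := cN.comp c1
    have cL : ContDiff ℝ 1 (fun x : CssE × ℝ => S x.1 - (2 : ℝ) • x.1 + S' x.1) :=
      ((S.contDiff.comp c1).sub (c1.const_smul (2 : ℝ))).add (S'.contDiff.comp c1)
    have ch : ContDiffOn ℝ 1 (fun x : CssE × ℝ => 1 / x.2 ^ 2) (Set.univ ×ˢ Set.Ioi (0 : ℝ)) :=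
      contDiffOn_const.div (c2.pow 2).contDiffOn fun x hx => pow_ne_zero 2 (ne_of_gt hx.2)
    exact ((((cNN.const_smul lam).sub (c1.const_smul Ω)).add
      (((c2.pow 2).div_const 4).smul cM)).contDiffOn).add (ch.smul cL.contDiffOn)
end

section
/- Fix Ω > 0, λ > 0, p > 0 and 𝗁 > 0, and let 𝒱(𝗁) denote the unique positive root V of (1/4)V⁴ + λ𝗁 V^{2p} = Ω. Then there exist ε₀ > 0, r > 0 and C > 0 such that for every ε ∈ (0, ε₀) there exists a unique V ∈ ℓ¹(ℤ, ℝ) with ‖V − 𝒱(𝗁)·δ₀‖_{ℓ¹} ≤ r satisfying, for all n ∈ ℤ, ( λ𝗁 |V_n|^{2p} − Ω + (1/4)·Σ_{k=n}^{∞} V_k⁴ )·V_n + ε·(V_{n+1} − 2V_n + V_{n−1}) = 0; moreover this solution satisfies ‖V − 𝒱(𝗁)·δ₀‖_{ℓ¹} ≤ C·ε. -/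
/-- The discrete delta sequence `[δ₀]ₙ = 1` if `n = 0` and `0` otherwise. -/
noncomputable def deltaSeq : ℤ → ℝ := fun n => if n = 0 then 1 else 0

open Filter Topology

lemma ss_gstrict (c p : ℝ) (hp : 0 < p) (x0 : ℝ) :
    HasStrictDerivAt (fun x : ℝ => c * |x| ^ (2 * p) * x) (c * (2 * p + 1) * |x0| ^ (2 * p)) x0 := by
  have hd : ∀ x : ℝ, HasDerivAt (fun x : ℝ => c * |x| ^ (2 * p) * x)
      (c * (2 * p + 1) * |x| ^ (2 * p)) x := by
    intro x
    by_cases hx : x = 0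
    · subst hx
      have hc : Continuous (fun x : ℝ => c * |x| ^ (2 * p)) :=
        continuous_const.mul (continuous_abs.rpow_const (fun _ => Or.inr (by positivity)))
      rw [hasDerivAt_iff_tendsto_slope]
      have h0 : (0:ℝ) ^ (2 * p) = 0 := Real.zero_rpow (by positivity)
      have := (hc.tendsto 0).mono_left (nhdsWithin_le_nhds (s := {0}ᶜ))
      simp only [abs_zero, h0, mul_zero] at this ⊢
      refine this.congr' ?_
      filter_upwards [self_mem_nhdsWithin] with y hy
      have hy' : y ≠ 0 := hy
      simp [slope_def_field]
      field_simp
    · have h1 : HasDerivAt (fun x : ℝ => |x|) (SignType.sign x : ℝ) x := hasDerivAt_abs hx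
      have h2 := h1.rpow_const (p := 2 * p) (Or.inl (abs_ne_zero.mpr hx))
      have h3 := (h2.const_mul c).mul (hasDerivAt_id x)
      refine h3.congr_deriv ?_
      have h4 : |x| ^ (2 * p) = |x| ^ (2 * p - 1) * |x| := by
        rw [← Real.rpow_add_one (abs_ne_zero.mpr hx)]; ring_nf
      have h5 : (SignType.sign x : ℝ) * x = |x| := sign_mul_self x
      simp only [id, mul_one]
      rw [h4]
      linear_combination (2 * p * c * |x| ^ (2 * p - 1)) * h5
  refine hasStrictDerivAt_of_hasDerivAt_of_continuousAt (Eventually.of_forall hd) ?_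
  exact (continuous_const.mul
    (continuous_abs.rpow_const (fun _ => Or.inr (by positivity)))).continuousAt

lemma ss_gbound (c p : ℝ) (hp : 0 < p) (x0 η : ℝ) (hη : 0 < η) :
    ∃ r > 0, ∀ x y : ℝ, |x - x0| ≤ r → |y - x0| ≤ r →
      |c * |x| ^ (2 * p) * x - c * |y| ^ (2 * p) * y
        - (c * (2 * p + 1) * |x0| ^ (2 * p)) * (x - y)| ≤ η * |x - y| := by
  have h := (ss_gstrict c p hp x0).isLittleO
  have h2 := h.def hη
  rw [Metric.eventually_nhds_iff] at h2
  obtain ⟨r, hr, h3⟩ := h2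
  refine ⟨r / 2, by positivity, fun x y hx hy => ?_⟩
  have := @h3 (x, y) (by
    rw [Prod.dist_eq, Real.dist_eq, Real.dist_eq]
    exact max_lt (by simpa using by linarith) (by simpa using by linarith))
  simpa [mul_comm] using this

lemma ss_q1 (M x y : ℝ) (hx : |x| ≤ M) (hy : |y| ≤ M) :
    |x ^ 4 - y ^ 4| ≤ 4 * M ^ 3 * |x - y| := by
  have hM : 0 ≤ M := (abs_nonneg x).trans hx
  have e : x ^ 4 - y ^ 4 = (x ^ 3 + x ^ 2 * y + x * y ^ 2 + y ^ 3) * (x - y) := by ring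
  rw [e, abs_mul]
  gcongr
  calc |x ^ 3 + x ^ 2 * y + x * y ^ 2 + y ^ 3|
      ≤ |x ^ 3| + |x ^ 2 * y| + |x * y ^ 2| + |y ^ 3| := by
        refine (abs_add_le _ _).trans ?_
        gcongr
        refine (abs_add_le _ _).trans ?_
        gcongr
        exact abs_add_le _ _
    _ = |x| ^ 3 + |x| ^ 2 * |y| + |x| * |y| ^ 2 + |y| ^ 3 := by simp [abs_mul, abs_pow]
    _ ≤ M ^ 3 + M ^ 2 * M + M * M ^ 2 + M ^ 3 := by gcongr
    _ = 4 * M ^ 3 := by ring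

lemma ss_c3 (M r a b c z : ℝ) (ha : |a| ≤ M) (hb : |b| ≤ M) (hz : |z| ≤ M)
    (ha' : |a - z| ≤ r) (hb' : |b - z| ≤ r) (hc' : |c - z| ≤ r) :
    |a * b * c - z ^ 3| ≤ 3 * M ^ 2 * r := by
  have hM : 0 ≤ M := (abs_nonneg a).trans ha
  have hr : 0 ≤ r := (abs_nonneg _).trans ha'
  have e : a * b * c - z ^ 3 = a * b * (c - z) + a * (b - z) * z + (a - z) * z * z := by ring
  rw [e]
  calc _ ≤ |a * b * (c - z)| + |a * (b - z) * z| + |(a - z) * z * z| := by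
        refine (abs_add_le _ _).trans ?_
        gcongr
        exact abs_add_le _ _
    _ = |a| * |b| * |c - z| + |a| * |b - z| * |z| + |a - z| * |z| * |z| := by simp [abs_mul]
    _ ≤ M * M * r + M * r * M + r * M * M := by gcongr
    _ = _ := by ring

lemma ss_q2 (M r x y z : ℝ) (hx : |x| ≤ M) (hy : |y| ≤ M) (hz : |z| ≤ M)
    (hx' : |x - z| ≤ r) (hy' : |y - z| ≤ r) :
    |x ^ 4 - y ^ 4 - 4 * z ^ 3 * (x - y)| ≤ 12 * M ^ 2 * r * |x - y| := by
  have e : x ^ 4 - y ^ 4 - 4 * z ^ 3 * (x - y) =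
    ((x*x*x - z^3) + (x*x*y - z^3) + (x*y*y - z^3) + (y*y*y - z^3)) * (x - y) := by ring
  rw [e, abs_mul]
  gcongr
  have h1 := ss_c3 M r x x x z hx hx hz hx' hx' hx'
  have h2 := ss_c3 M r x x y z hx hx hz hx' hx' hy'
  have h3 := ss_c3 M r x y y z hx hy hz hx' hy' hy'
  have h4 := ss_c3 M r y y y z hy hy hz hy' hy' hy'
  have t1 := abs_add_le ((x*x*x - z^3) + (x*x*y - z^3) + (x*y*y - z^3)) (y*y*y - z^3)
  have t2 := abs_add_le ((x*x*x - z^3) + (x*x*y - z^3)) (x*y*y - z^3)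
  have t3 := abs_add_le (x*x*x - z^3) (x*x*y - z^3)
  linarith

lemma ss_tb (a d : ℤ → ℝ) (c : ℝ) (hd : Summable fun n => |d n|) (h : ∀ k, |a k| ≤ c * |d k|) :
    Summable a ∧ |∑' k, a k| ≤ c * ∑' k, |d k| := by
  have h1 : Summable fun k => c * |d k| := hd.mul_left c
  refine ⟨Summable.of_norm_bounded h1 h, ?_⟩
  rw [← tsum_mul_left]
  rw [← Real.norm_eq_abs]
  exact tsum_of_norm_bounded h1.hasSum h

lemma ss_le (f : ℤ → ℝ) (hf : Summable fun n => |f n|) (n : ℤ) : |f n| ≤ ∑' k, |f k| :=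
  hf.le_tsum n (fun _ _ => abs_nonneg _)

noncomputable def ssS (V : ℤ → ℝ) (n : ℤ) : ℝ := ∑' k : ℤ, (if n ≤ k then (V k) ^ 4 else 0)

lemma ss_Ssum (V : ℤ → ℝ) (hV : Summable fun n => |V n|) (n : ℤ) :
    Summable fun k : ℤ => (if n ≤ k then (V k) ^ 4 else 0) := by
  refine (ss_tb _ V (4 * (∑' k, |V k|) ^ 3) hV fun k => ?_).1
  have hN : 0 ≤ ∑' k, |V k| := tsum_nonneg fun _ => abs_nonneg _
  split_ifs
  · simpa using ss_q1 _ (V k) 0 (ss_le V hV k) (by simpa using hN)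
  · simp; positivity

lemma ss_S1 (V V' : ℤ → ℝ) (hV : Summable fun n => |V n|) (hV' : Summable fun n => |V' n|)
    (M : ℝ) (hM : ∀ k, |V k| ≤ M) (hM' : ∀ k, |V' k| ≤ M)
    (hd : Summable fun n => |V n - V' n|) (n : ℤ) :
    |ssS V n - ssS V' n| ≤ 4 * M ^ 3 * ∑' k, |V k - V' k| := by
  unfold ssS
  rw [← (ss_Ssum V hV n).tsum_sub (ss_Ssum V' hV' n)]
  have hM0 : 0 ≤ M := (abs_nonneg _).trans (hM 0)
  refine (ss_tb _ (fun k => V k - V' k) (4 * M ^ 3) hd fun k => ?_).2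
  split_ifs
  · exact ss_q1 _ _ _ (hM k) (hM' k)
  · simp; positivity

lemma ss_S2 (v : ℝ) (V V' : ℤ → ℝ) (hV : Summable fun n => |V n|) (hV' : Summable fun n => |V' n|)
    (M r : ℝ) (hM : ∀ k, |V k| ≤ M) (hM' : ∀ k, |V' k| ≤ M) (hz : ∀ k, |v * deltaSeq k| ≤ M)
    (hr : ∀ k, |V k - v * deltaSeq k| ≤ r) (hr' : ∀ k, |V' k - v * deltaSeq k| ≤ r)
    (hd : Summable fun n => |V n - V' n|) :
    |ssS V 0 - ssS V' 0 - 4 * v ^ 3 * (V 0 - V' 0)| ≤ 12 * M ^ 2 * r * ∑' k, |V k - V' k| := by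
  have hh : HasSum (fun k : ℤ => if k = 0 then 4 * v ^ 3 * (V 0 - V' 0) else 0)
    (4 * v ^ 3 * (V 0 - V' 0)) := hasSum_ite_eq 0 _
  have h3 := ((ss_Ssum V hV 0).hasSum.sub (ss_Ssum V' hV' 0).hasSum).sub hh
  unfold ssS
  rw [← h3.tsum_eq]
  have hr0 : 0 ≤ r := (abs_nonneg _).trans (hr 0)
  refine (ss_tb _ (fun k => V k - V' k) (12 * M ^ 2 * r) hd fun k => ?_).2
  have hq := ss_q2 M r _ _ _ (hM k) (hM' k) (hz k) (hr k) (hr' k)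
  by_cases hk : k = 0
  · subst hk
    simpa [deltaSeq] using hq
  · by_cases hk2 : 0 ≤ k
    · simpa [deltaSeq, hk, hk2] using hq
    · simp [hk, hk2]; positivity

lemma ss_S0 (v : ℝ) (n : ℤ) : ssS (fun k => v * deltaSeq k) n = if n ≤ 0 then v ^ 4 else 0 := by
  unfold ssS
  rw [tsum_eq_single 0]
  · simp [deltaSeq]
  · intro k hk; simp [deltaSeq, hk]

lemma ss_mem (f : ℤ → ℝ) : Memℓp f 1 ↔ Summable fun n => |f n| := by
  rw [memℓp_gen_iff (by simp)]; simp

lemma ss_norm (f : lp (fun _ : ℤ => ℝ) 1) : ‖f‖ = ∑' n, |f n| := by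
  rw [lp.norm_eq_tsum_rpow (by simp)]; simp

/-- Banach fixed point in the `ℓ¹` ball. -/
lemma ss_banach (T : (ℤ → ℝ) → (ℤ → ℝ)) (V0 : ℤ → ℝ) (h0 : Summable fun n => |V0 n|)
    (r : ℝ) (hr : 0 ≤ r)
    (hT0 : Summable fun n => |T V0 n - V0 n|) (hT0' : ∑' n, |T V0 n - V0 n| ≤ r / 2)
    (hT : ∀ V V' : ℤ → ℝ, (Summable fun n => |V n|) → (Summable fun n => |V' n|) →
      ∑' n, |V n - V0 n| ≤ r → ∑' n, |V' n - V0 n| ≤ r →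
      (Summable fun n => |T V n - T V' n|) ∧
        ∑' n, |T V n - T V' n| ≤ 1 / 2 * ∑' n, |V n - V' n|) :
    ∃ V : ℤ → ℝ, (Summable fun n => |V n|) ∧ ∑' n, |V n - V0 n| ≤ r ∧ T V = V := by
  let E := lp (fun _ : ℤ => ℝ) 1
  let v0 : E := ⟨V0, (ss_mem V0).2 h0⟩
  let X := Metric.closedBall v0 r
  have hX : ∀ x : X, (Summable fun n => |x.1 n|) ∧ ∑' n, |x.1 n - V0 n| ≤ r := by
    intro x
    refine ⟨(ss_mem _).1 (lp.memℓp x.1), ?_⟩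
    have := x.2
    rw [Metric.mem_closedBall, dist_eq_norm, ss_norm] at this
    exact this
  have hV0r : ∑' n, |V0 n - V0 n| ≤ r := by simpa using hr
  have hTs : ∀ x : X, Memℓp (T x.1) 1 := by
    intro x
    rw [ss_mem]
    have h1 := (hT x.1 V0 (hX x).1 h0 (hX x).2 hV0r).1
    refine Summable.of_nonneg_of_le (fun _ => abs_nonneg _) (fun n => ?_) ((h1.add hT0).add h0)
    have e : T x.1 n = (T x.1 n - T V0 n) + (T V0 n - V0 n) + V0 n := by ring
    calc |T x.1 n| = |(T x.1 n - T V0 n) + (T V0 n - V0 n) + V0 n| := by rw [← e]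
      _ ≤ _ := (abs_add_le _ _).trans (by gcongr; exact abs_add_le _ _)
  have hTb : ∀ x : X, (⟨T x.1, hTs x⟩ : E) ∈ Metric.closedBall v0 r := by
    intro x
    rw [Metric.mem_closedBall, dist_eq_norm, ss_norm]
    change ∑' n, |T x.1 n - V0 n| ≤ r
    obtain ⟨h1, h2⟩ := (hT x.1 V0 (hX x).1 h0 (hX x).2 hV0r)
    have hle : ∀ n, |T x.1 n - V0 n| ≤ |T x.1 n - T V0 n| + |T V0 n - V0 n| :=
      fun n => abs_sub_le _ _ _
    have h3 : Summable fun n => |T x.1 n - V0 n| :=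
      Summable.of_nonneg_of_le (fun _ => abs_nonneg _) hle (h1.add hT0)
    have h4 := h3.tsum_le_tsum hle (h1.add hT0)
    rw [h1.tsum_add hT0] at h4
    have := (hX x).2
    linarith
  let F : X → X := fun x => ⟨⟨T x.1, hTs x⟩, hTb x⟩
  have hF : ContractingWith (1 / 2) F := by
    refine ⟨by rw [← NNReal.coe_lt_coe]; norm_num, ?_⟩
    refine LipschitzWith.of_dist_le_mul fun x y => ?_
    rw [Subtype.dist_eq, Subtype.dist_eq, dist_eq_norm, dist_eq_norm, ss_norm, ss_norm]
    have := (hT x.1 y.1 (hX x).1 (hX y).1 (hX x).2 (hX y).2).2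
    rw [show (((1 / 2 : NNReal)) : ℝ) = 1 / 2 by norm_num]
    exact this
  have : Nonempty X := ⟨⟨v0, Metric.mem_closedBall_self hr⟩⟩
  have : CompleteSpace X := Metric.isClosed_closedBall.completeSpace_coe
  have hfix := hF.fixedPoint_isFixedPt
  set x := ContractingWith.fixedPoint F hF
  refine ⟨x.1, (hX x).1, (hX x).2, ?_⟩
  have h5 : (F x).1 = x.1 := congrArg Subtype.val hfix
  exact congrArg (fun z : E => (z : ℤ → ℝ)) h5

noncomputable def ssF (c Ω p : ℝ) (V : ℤ → ℝ) (n : ℤ) : ℝ :=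
  (c * |V n| ^ (2 * p) - Ω + (1 / 4) * ssS V n) * V n

noncomputable def ssL (c Ω p v : ℝ) (n : ℤ) : ℝ :=
  c * (2 * p + 1) * |v * deltaSeq n| ^ (2 * p) - Ω
    + (1 / 4) * ssS (fun k => v * deltaSeq k) n + (v * deltaSeq n) ^ 4

lemma ss_L_bound (c Ω p v : ℝ) (hc : 0 < c) (hΩ : 0 < Ω) (hp : 0 < p) (hv : 0 < v)
    (hroot : (1 / 4) * v ^ 4 + c * v ^ (2 * p) = Ω) :
    ∃ B > 0, ∀ n, ssL c Ω p v n ≠ 0 ∧ |(ssL c Ω p v n)⁻¹| ≤ B := by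
  have hw : 0 < v ^ (2 * p) := Real.rpow_pos_of_pos hv _
  have hA : 0 < 2 * p * c * v ^ (2 * p) + v ^ 4 := by positivity
  have hC : 0 < c * v ^ (2 * p) := by positivity
  have h0 : (0:ℝ) ^ (2 * p) = 0 := Real.zero_rpow (by positivity)
  refine ⟨(2 * p * c * v ^ (2 * p) + v ^ 4)⁻¹ + Ω⁻¹ + (c * v ^ (2 * p))⁻¹, by positivity, ?_⟩
  have i1 := inv_pos.2 hA
  have i2 := inv_pos.2 hΩ
  have i3 := inv_pos.2 hC
  intro n
  rcases lt_trichotomy n 0 with hn | hn | hn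
  · have e : ssL c Ω p v n = -(c * v ^ (2 * p)) := by
      rw [ssL, ss_S0]; simp [deltaSeq, hn.ne, hn.le, h0]; linarith
    rw [e]
    refine ⟨neg_ne_zero.2 hC.ne', ?_⟩
    rw [inv_neg, abs_neg, abs_of_pos i3]; linarith
  · subst hn
    have e : ssL c Ω p v 0 = 2 * p * c * v ^ (2 * p) + v ^ 4 := by
      rw [ssL, ss_S0]; simp [deltaSeq, abs_of_pos hv]; linarith
    rw [e]
    refine ⟨hA.ne', ?_⟩
    rw [abs_of_pos i1]; linarith
  · have e : ssL c Ω p v n = -Ω := by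
      rw [ssL, ss_S0]; simp [deltaSeq, hn.ne', hn, h0]
    rw [e]
    refine ⟨neg_ne_zero.2 hΩ.ne', ?_⟩
    rw [inv_neg, abs_neg, abs_of_pos i2]; linarith

lemma ss_F0 (c Ω p v : ℝ) (hv : 0 < v)
    (hroot : (1 / 4) * v ^ 4 + c * v ^ (2 * p) = Ω) (n : ℤ) :
    ssF c Ω p (fun k => v * deltaSeq k) n = 0 := by
  by_cases hn : n = 0
  · subst hn
    rw [ssF, ss_S0]; simp [deltaSeq, abs_of_pos hv]
    left; linarith
  · simp [ssF, deltaSeq, hn]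

lemma ss_rem (c Ω p v : ℝ) (hp : 0 < p) (hv : 0 < v) (η : ℝ) (hη : 0 < η) :
    ∃ r > 0, ∀ V V' : ℤ → ℝ, (Summable fun n => |V n|) → (Summable fun n => |V' n|) →
      ∑' n, |V n - v * deltaSeq n| ≤ r → ∑' n, |V' n - v * deltaSeq n| ≤ r →
      (Summable fun n => |ssF c Ω p V n - ssF c Ω p V' n - ssL c Ω p v n * (V n - V' n)|) ∧
        ∑' n, |ssF c Ω p V n - ssF c Ω p V' n - ssL c Ω p v n * (V n - V' n)|
          ≤ η * ∑' n, |V n - V' n| := by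
  obtain ⟨r1, hr1, hg1⟩ := ss_gbound c p hp 0 (η / 2) (by positivity)
  obtain ⟨r2, hr2, hg2⟩ := ss_gbound c p hp v (η / 2) (by positivity)
  set M := v + 1 with hMdef
  have hM0 : 0 < M := by positivity
  set Q := 2 * M ^ 3 + 3 * v * M ^ 2 with hQ
  have hQ0 : 0 < Q := by positivity
  set r := min (min r1 r2) (min 1 (η / 2 / Q)) with hr
  have hr0 : 0 < r := by positivity
  have hrr1 : r ≤ r1 := (min_le_left _ _).trans (min_le_left _ _)
  have hrr2 : r ≤ r2 := (min_le_left _ _).trans (min_le_right _ _)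
  have hr1' : r ≤ 1 := (min_le_right _ _).trans (min_le_left _ _)
  have hrQ : Q * r ≤ η / 2 := by
    have : r ≤ η / 2 / Q := (min_le_right _ _).trans (min_le_right _ _)
    rw [le_div_iff₀ hQ0] at this
    linarith
  refine ⟨r, hr0, fun V V' hV hV' hb hb' => ?_⟩
  have hg : ∀ n x y : ℝ, (n = 0 ∨ n = v) → |x - n| ≤ r → |y - n| ≤ r →
      |c * |x| ^ (2 * p) * x - c * |y| ^ (2 * p) * y
        - (c * (2 * p + 1) * |n| ^ (2 * p)) * (x - y)| ≤ η / 2 * |x - y| := by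
    rintro n x y (rfl | rfl) hx hy
    · exact hg1 x y (hx.trans hrr1) (hy.trans hrr1)
    · exact hg2 x y (hx.trans hrr2) (hy.trans hrr2)
  have hδ : ∀ n, v * deltaSeq n = 0 ∨ v * deltaSeq n = v := by
    intro n; by_cases h : n = 0 <;> simp [deltaSeq, h]
  have hs0 : HasSum (fun n => |v * deltaSeq n|) v := by
    have : (fun n => |v * deltaSeq n|) = fun n : ℤ => if n = 0 then v else 0 := by
      ext n; by_cases h : n = 0 <;> simp [deltaSeq, h, abs_of_pos hv]
    rw [this]; exact hasSum_ite_eq 0 v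
  have hsub : ∀ f g : ℤ → ℝ, (Summable fun n => |f n|) → (Summable fun n => |g n|) →
      Summable fun n => |f n - g n| := fun f g hf hg =>
    Summable.of_nonneg_of_le (fun _ => abs_nonneg _) (fun n => abs_sub _ _) (hf.add hg)
  have hd := hsub V V' hV hV'
  have hw := hsub V _ hV hs0.summable
  have hw' := hsub V' _ hV' hs0.summable
  have hzM : ∀ k, |v * deltaSeq k| ≤ M := by
    intro k
    rcases hδ k with h | h <;> rw [h]
    · simpa using hM0.le
    · rw [abs_of_pos hv]; linarith
  have hzv : ∀ k, |v * deltaSeq k| ≤ v := by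
    intro k
    rcases hδ k with h | h <;> rw [h]
    · simpa using hv.le
    · rw [abs_of_pos hv]
  have hpt : ∀ k, |V k - v * deltaSeq k| ≤ r := fun k =>
    (ss_le (fun k => V k - v * deltaSeq k) hw k).trans hb
  have hpt' : ∀ k, |V' k - v * deltaSeq k| ≤ r := fun k =>
    (ss_le (fun k => V' k - v * deltaSeq k) hw' k).trans hb'
  have hVM : ∀ k, |V k| ≤ M := fun k => by
    have := abs_sub_abs_le_abs_sub (V k) (v * deltaSeq k)
    linarith [hpt k, hzv k]
  have hVM' : ∀ k, |V' k| ≤ M := fun k => by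
    have := abs_sub_abs_le_abs_sub (V' k) (v * deltaSeq k)
    linarith [hpt' k, hzv k]
  set N := ∑' n, |V n - V' n| with hN
  have hN0 : 0 ≤ N := tsum_nonneg fun _ => abs_nonneg _
  have key : ∀ n, |ssF c Ω p V n - ssF c Ω p V' n - ssL c Ω p v n * (V n - V' n)|
      ≤ (η / 2 + M ^ 3 * r) * |V n - V' n| + M ^ 3 * N * |V' n - v * deltaSeq n|
        + 3 * M ^ 2 * r * N * |v * deltaSeq n| := by
    intro n
    have a1 := hg _ _ _ (hδ n) (hpt n) (hpt' n)
    have a2 : |ssS V n - ssS (fun k => v * deltaSeq k) n| ≤ 4 * M ^ 3 * r :=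
      (ss_S1 V _ hV hs0.summable M hVM hzM hw n).trans (by gcongr)
    have a3 : |ssS V n - ssS V' n| ≤ 4 * M ^ 3 * N := ss_S1 V V' hV hV' M hVM hVM' hd n
    have a4 : |v * deltaSeq n * (ssS V n - ssS V' n) - 4 * (v * deltaSeq n) ^ 4 * (V n - V' n)|
        ≤ 12 * M ^ 2 * r * N * |v * deltaSeq n| := by
      by_cases hn : n = 0
      · subst hn
        have := ss_S2 v V V' hV hV' M r hVM hVM' hzM hpt hpt' hd
        have e : v * deltaSeq 0 * (ssS V 0 - ssS V' 0) - 4 * (v * deltaSeq 0) ^ 4 * (V 0 - V' 0)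
          = (ssS V 0 - ssS V' 0 - 4 * v ^ 3 * (V 0 - V' 0)) * (v * deltaSeq 0) := by
          simp [deltaSeq]; ring
        rw [e, abs_mul]
        gcongr
      · simp [deltaSeq, hn]
    set d := V n - V' n with hdd
    set z := v * deltaSeq n with hz
    set S0 := ssS (fun k => v * deltaSeq k) n with hS0
    have e : ssF c Ω p V n - ssF c Ω p V' n - ssL c Ω p v n * d =
        (c * |V n| ^ (2 * p) * V n - c * |V' n| ^ (2 * p) * V' n
          - (c * (2 * p + 1) * |z| ^ (2 * p)) * d)
        + (1 / 4) * ((ssS V n - S0) * d) + (1 / 4) * ((ssS V n - ssS V' n) * (V' n - z))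
        + (1 / 4) * (z * (ssS V n - ssS V' n) - 4 * z ^ 4 * d) := by
      simp only [ssF, ssL, ← hz, ← hS0, hdd]; ring
    rw [e]
    have b2 : |(1 / 4) * ((ssS V n - S0) * d)| ≤ (1 / 4) * (4 * M ^ 3 * r * |d|) := by
      rw [abs_mul, abs_mul, abs_of_pos (by norm_num : (0:ℝ) < 1 / 4)]; gcongr
    have b3 : |(1 / 4) * ((ssS V n - ssS V' n) * (V' n - z))|
        ≤ (1 / 4) * (4 * M ^ 3 * N * |V' n - z|) := by
      rw [abs_mul, abs_mul, abs_of_pos (by norm_num : (0:ℝ) < 1 / 4)]; gcongr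
    have b4 : |(1 / 4) * (z * (ssS V n - ssS V' n) - 4 * z ^ 4 * d)|
        ≤ (1 / 4) * (12 * M ^ 2 * r * N * |z|) := by
      rw [abs_mul, abs_of_pos (by norm_num : (0:ℝ) < 1 / 4)]; gcongr
    refine (abs_add_le _ _).trans ?_
    refine (add_le_add_left (abs_add_le _ _) _).trans ?_
    refine (add_le_add_left (add_le_add_left (abs_add_le _ _) _) _).trans ?_
    linarith
  have hsumb := ((hd.mul_left (η / 2 + M ^ 3 * r)).add (hw'.mul_left (M ^ 3 * N))).add
    (hs0.summable.mul_left (3 * M ^ 2 * r * N))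
  have hsum := Summable.of_nonneg_of_le (fun _ => abs_nonneg _) key hsumb
  refine ⟨hsum, (hsum.tsum_le_tsum key hsumb).trans ?_⟩
  rw [((hd.mul_left (η / 2 + M ^ 3 * r)).add (hw'.mul_left (M ^ 3 * N))).tsum_add
    (hs0.summable.mul_left (3 * M ^ 2 * r * N)), (hd.mul_left (η / 2 + M ^ 3 * r)).tsum_add
    (hw'.mul_left (M ^ 3 * N)), tsum_mul_left, tsum_mul_left, tsum_mul_left, hs0.tsum_eq, ← hN]
  calc _ ≤ (η / 2 + M ^ 3 * r) * N + M ^ 3 * N * r + 3 * M ^ 2 * r * N * v := by gcongr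
    _ = (η / 2 + Q * r) * N := by rw [hQ]; ring
    _ ≤ (η / 2 + η / 2) * N := by gcongr
    _ = η * N := by ring

lemma ss_lap (f : ℤ → ℝ) (hf : Summable fun n => |f n|) :
    (Summable fun n => |f (n + 1) - 2 * f n + f (n - 1)|) ∧
      ∑' n, |f (n + 1) - 2 * f n + f (n - 1)| ≤ 4 * ∑' n, |f n| := by
  have h1 : HasSum (fun n => |f (n + 1)|) (∑' n, |f n|) :=
    (Equiv.addRight (1:ℤ)).hasSum_iff.2 hf.hasSum
  have h2 : HasSum (fun n => |f (n - 1)|) (∑' n, |f n|) :=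
    (Equiv.subRight (1:ℤ)).hasSum_iff.2 hf.hasSum
  have h3 := (h1.add (hf.hasSum.mul_left 2)).add h2
  have hle : ∀ n, |f (n + 1) - 2 * f n + f (n - 1)| ≤ |f (n + 1)| + 2 * |f n| + |f (n - 1)| := by
    intro n
    refine (abs_add_le _ _).trans ?_
    gcongr
    refine (abs_sub _ _).trans ?_
    rw [abs_mul, abs_two]
  have hs := Summable.of_nonneg_of_le (fun _ => abs_nonneg _) hle h3.summable
  refine ⟨hs, (hs.tsum_le_tsum hle h3.summable).trans ?_⟩
  rw [h3.tsum_eq]; linarith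

theorem single_site_persistence
    (lam Ω p κ : ℝ) (hlam : 0 < lam) (hΩ : 0 < Ω) (hp : 0 < p) (hκ : 0 < κ)
    (𝒱 : ℝ) (h𝒱pos : 0 < 𝒱)
    (h𝒱root : (1 / 4) * 𝒱 ^ 4 + lam * κ * 𝒱 ^ (2 * p) = Ω) :
    ∃ ε₀ > (0 : ℝ), ∃ r > (0 : ℝ), ∃ C > (0 : ℝ), ∀ ε : ℝ, 0 < ε → ε < ε₀ →
      (∃! V : ℤ → ℝ,
        Summable (fun n => |V n|)
        ∧ (∑' n : ℤ, |V n - 𝒱 * deltaSeq n|) ≤ r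
        ∧ ∀ n : ℤ,
          (lam * κ * |V n| ^ (2 * p) - Ω
              + (1 / 4) * ∑' k : ℤ, (if n ≤ k then (V k) ^ 4 else 0)) * V n
            + ε * (V (n + 1) - 2 * V n + V (n - 1)) = 0)
      ∧ (∀ V : ℤ → ℝ,
          Summable (fun n => |V n|) →
          (∑' n : ℤ, |V n - 𝒱 * deltaSeq n|) ≤ r →
          (∀ n : ℤ,
            (lam * κ * |V n| ^ (2 * p) - Ω
                + (1 / 4) * ∑' k : ℤ, (if n ≤ k then (V k) ^ 4 else 0)) * V n
              + ε * (V (n + 1) - 2 * V n + V (n - 1)) = 0) →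
          (∑' n : ℤ, |V n - 𝒱 * deltaSeq n|) ≤ C * ε) := by
  have hc : 0 < lam * κ := by positivity
  obtain ⟨B, hB, hL⟩ := ss_L_bound (lam * κ) Ω p 𝒱 hc hΩ hp h𝒱pos h𝒱root
  obtain ⟨r, hr, hrem⟩ := ss_rem (lam * κ) Ω p 𝒱 hp h𝒱pos (1 / (4 * B)) (by positivity)
  have hs0 : HasSum (fun n => |𝒱 * deltaSeq n|) 𝒱 := by
    have : (fun n => |𝒱 * deltaSeq n|) = fun n : ℤ => if n = 0 then 𝒱 else 0 := by
      ext n; by_cases h : n = 0 <;> simp [deltaSeq, h, abs_of_pos h𝒱pos]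
    rw [this]; exact hasSum_ite_eq 0 𝒱
  refine ⟨min (1 / (16 * B)) (r / (8 * B * 𝒱)), by positivity, r, hr, 8 * B * 𝒱, by positivity,
    fun ε hε hε0 => ?_⟩
  have hε1 : 4 * B * ε ≤ 1 / 4 := by
    have := hε0.le.trans (min_le_left _ _)
    rw [le_div_iff₀ (by positivity)] at this; linarith
  have hε2 : 4 * B * 𝒱 * ε ≤ r / 2 := by
    have := hε0.le.trans (min_le_right _ _)
    rw [le_div_iff₀ (by positivity)] at this; linarith
  set V0 : ℤ → ℝ := fun n => 𝒱 * deltaSeq n with hV0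
  set L := ssL (lam * κ) Ω p 𝒱 with hLdef
  set F := ssF (lam * κ) Ω p with hFdef
  set T : (ℤ → ℝ) → ℤ → ℝ := fun V n =>
    V n - (L n)⁻¹ * (F V n + ε * (V (n + 1) - 2 * V n + V (n - 1))) with hT
  have hiff : ∀ V : ℤ → ℝ, (∀ n : ℤ,
          (lam * κ * |V n| ^ (2 * p) - Ω
              + (1 / 4) * ∑' k : ℤ, (if n ≤ k then (V k) ^ 4 else 0)) * V n
            + ε * (V (n + 1) - 2 * V n + V (n - 1)) = 0) ↔ T V = V := by
    intro V
    rw [funext_iff]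
    refine forall_congr' fun n => ?_
    change F V n + _ = 0 ↔ V n - (L n)⁻¹ * _ = V n
    rw [sub_eq_self, mul_eq_zero, inv_eq_zero]
    simp [(hL n).1]
  have hT0 : (Summable fun n => |T V0 n - V0 n|) ∧ ∑' n, |T V0 n - V0 n| ≤ 4 * B * 𝒱 * ε := by
    obtain ⟨l1, l2⟩ := ss_lap V0 hs0.summable
    have hle : ∀ n, |T V0 n - V0 n| ≤ B * ε * |V0 (n + 1) - 2 * V0 n + V0 (n - 1)| := by
      intro n
      have hF0 : F V0 n = 0 := ss_F0 (lam * κ) Ω p 𝒱 h𝒱pos h𝒱root n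
      have e : T V0 n - V0 n = -((L n)⁻¹ * (ε * (V0 (n + 1) - 2 * V0 n + V0 (n - 1)))) := by
        simp only [hT, hF0]; ring
      rw [e, abs_neg, abs_mul, abs_mul, abs_of_pos hε, mul_assoc]
      gcongr
      exact (hL n).2
    have hs := Summable.of_nonneg_of_le (fun _ => abs_nonneg _) hle (l1.mul_left (B * ε))
    refine ⟨hs, (hs.tsum_le_tsum hle (l1.mul_left (B * ε))).trans ?_⟩
    rw [tsum_mul_left]
    rw [hs0.tsum_eq] at l2
    calc _ ≤ B * ε * (4 * 𝒱) := by gcongr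
      _ = _ := by ring
  have hTT : ∀ V V' : ℤ → ℝ, (Summable fun n => |V n|) → (Summable fun n => |V' n|) →
      ∑' n, |V n - V0 n| ≤ r → ∑' n, |V' n - V0 n| ≤ r →
      (Summable fun n => |T V n - T V' n|) ∧
        ∑' n, |T V n - T V' n| ≤ 1 / 2 * ∑' n, |V n - V' n| := by
    intro V V' hV hV' hb hb'
    obtain ⟨s1, s2⟩ := hrem V V' hV hV' hb hb'
    have hd : Summable fun n => |V n - V' n| :=
      Summable.of_nonneg_of_le (fun _ => abs_nonneg _) (fun n => abs_sub _ _) (hV.add hV')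
    obtain ⟨l1, l2⟩ := ss_lap (fun n => V n - V' n) hd
    have hN0 : 0 ≤ ∑' n, |V n - V' n| := tsum_nonneg fun _ => abs_nonneg _
    have hle : ∀ n, |T V n - T V' n| ≤ B * |F V n - F V' n - L n * (V n - V' n)|
        + B * ε * |(V (n + 1) - V' (n + 1)) - 2 * (V n - V' n) + (V (n - 1) - V' (n - 1))| := by
      intro n
      have hLn := mul_inv_cancel₀ (hL n).1
      have e : T V n - T V' n = -((L n)⁻¹ * (F V n - F V' n - L n * (V n - V' n))
          + (L n)⁻¹ * (ε * ((V (n + 1) - V' (n + 1)) - 2 * (V n - V' n)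
            + (V (n - 1) - V' (n - 1))))) := by
        simp only [hT]
        linear_combination (-(V n - V' n)) * hLn
      rw [e, abs_neg]
      refine (abs_add_le _ _).trans ?_
      rw [abs_mul, abs_mul (L n)⁻¹, abs_mul ε, abs_of_pos hε, mul_assoc B ε]
      gcongr
      · exact (hL n).2
      · exact (hL n).2
    have hsb := (s1.mul_left B).add (l1.mul_left (B * ε))
    have hs := Summable.of_nonneg_of_le (fun _ => abs_nonneg _) hle hsb
    refine ⟨hs, (hs.tsum_le_tsum hle hsb).trans ?_⟩
    rw [(s1.mul_left B).tsum_add (l1.mul_left (B * ε)), tsum_mul_left, tsum_mul_left]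
    calc _ ≤ B * (1 / (4 * B) * ∑' n, |V n - V' n|) + B * ε * (4 * ∑' n, |V n - V' n|) := by
          gcongr
      _ = (1 / 4 + 4 * B * ε) * ∑' n, |V n - V' n| := by field_simp
      _ ≤ (1 / 4 + 1 / 4) * ∑' n, |V n - V' n| := by gcongr
      _ = _ := by ring
  have hV0r : ∑' n, |V0 n - V0 n| ≤ r := by simpa using hr.le
  refine ⟨?_, ?_⟩
  · obtain ⟨V, h1, h2, h3⟩ := ss_banach T V0 hs0.summable r hr.le hT0.1 (hT0.2.trans hε2) hTT
    refine ⟨V, ⟨h1, h2, (hiff V).2 h3⟩, ?_⟩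
    rintro W ⟨w1, w2, w3⟩
    have w3 := (hiff W).1 w3
    have hh := (hTT W V w1 h1 w2 h2).2
    rw [w3, h3] at hh
    have hd : Summable fun n => |W n - V n| :=
      Summable.of_nonneg_of_le (fun _ => abs_nonneg _) (fun n => abs_sub _ _) (w1.add h1)
    funext n
    have h5 := ss_le (fun n => W n - V n) hd n
    have h6 : |W n - V n| ≤ 0 := by
      have : ∑' n, |W n - V n| ≤ 0 := by linarith
      exact h5.trans this
    exact sub_eq_zero.1 (abs_nonpos_iff.1 h6)
  · intro V h1 h2 h3
    have h3 := (hiff V).1 h3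
    obtain ⟨a1, a2⟩ := hTT V V0 h1 hs0.summable h2 hV0r
    rw [h3] at a1 a2
    have hle : ∀ n, |V n - V0 n| ≤ |V n - T V0 n| + |T V0 n - V0 n| := fun n => abs_sub_le _ _ _
    have hs : Summable fun n => |V n - V0 n| :=
      Summable.of_nonneg_of_le (fun _ => abs_nonneg _) hle (a1.add hT0.1)
    have h4 := hs.tsum_le_tsum hle (a1.add hT0.1)
    rw [a1.tsum_add hT0.1] at h4
    change ∑' n, |V n - V0 n| ≤ _
    linarith [hT0.2]
end

section
/- Fix λ > 0, Ω > 0 and p ∈ (0, 2). For h > 0 let 𝒰(h) denote the unique positive root x of λ x^{2p} + (h²/4) x⁴ = Ω. Then for every δ > 0 there exists h₀ > 0 such that for every h ≥ h₀ there exists a real sequence U ∈ ℓ¹(ℤ) satisfying, for all n ∈ ℤ, (1/h²)(U_{n+1} − 2U_n + U_{n−1}) − Ω U_n + G_n U_n + λ |U_n|^{2p} U_n = 0 with G_n = (h²/4)·Σ_{k=n}^{∞} U_k⁴, such that ‖U − 𝒰(h)·δ₀‖_{ℓ¹} ≤ δ·𝒰(h) and sup_{n∈ℤ} | G_n − (h²/4)𝒰(h)⁴·[χ₀]_n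 | ≤ δ·h²·𝒰(h)⁴. -/
/-- The discrete step sequence `[χ₀]ₙ = 1` if `n ≤ 0` and `0` otherwise. -/
noncomputable def stepSeq : ℤ → ℝ := fun n => if n ≤ 0 then 1 else 0

open Set Metric Filter Topology
open scoped BoundedContinuousFunction


def LB {E : Type*} [PseudoMetricSpace E] (s : Set E) (f : E → ℝ) (K : ℝ) : Prop :=
  (∀ X ∈ s, |f X| ≤ K) ∧ ∀ X ∈ s, ∀ Y ∈ s, |f X - f Y| ≤ K * dist X Y

section LBsec
variable {E : Type*} [PseudoMetricSpace E] {s : Set E} {f g : E → ℝ} {K L : ℝ}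

theorem LB.mono (h : LB s f K) (hKL : K ≤ L) : LB s f L :=
  ⟨fun X hX => (h.1 X hX).trans hKL, fun X hX Y hY => (h.2 X hX Y hY).trans
    (mul_le_mul_of_nonneg_right hKL dist_nonneg)⟩

theorem LB.const (c : ℝ) : LB s (fun _ => c) |c| :=
  ⟨fun _ _ => le_rfl, fun X _ Y _ => by simp; positivity⟩

theorem LB.add (hf : LB s f K) (hg : LB s g L) : LB s (fun X => f X + g X) (K + L) :=
  ⟨fun X hX => (abs_add_le _ _).trans (add_le_add (hf.1 X hX) (hg.1 X hX)),
   fun X hX Y hY => by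
    have h1 := hf.2 X hX Y hY
    have h2 := hg.2 X hX Y hY
    have : f X + g X - (f Y + g Y) = (f X - f Y) + (g X - g Y) := by ring
    rw [this]
    exact (abs_add_le _ _).trans (by linarith)⟩

theorem LB.cmul (c : ℝ) (hf : LB s f K) : LB s (fun X => c * f X) (|c| * K) :=
  ⟨fun X hX => by rw [abs_mul]; exact mul_le_mul_of_nonneg_left (hf.1 X hX) (abs_nonneg _),
   fun X hX Y hY => by
    rw [← mul_sub, abs_mul, mul_assoc]
    exact mul_le_mul_of_nonneg_left (hf.2 X hX Y hY) (abs_nonneg _)⟩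

theorem LB.neg (hf : LB s f K) : LB s (fun X => - f X) K :=
  ⟨fun X hX => by rw [abs_neg]; exact hf.1 X hX,
   fun X hX Y hY => by
    have : - f X - - f Y = -(f X - f Y) := by ring
    rw [this, abs_neg]; exact hf.2 X hX Y hY⟩

theorem LB.sub (hf : LB s f K) (hg : LB s g L) : LB s (fun X => f X - g X) (K + L) := by
  simpa [sub_eq_add_neg] using hf.add hg.neg

theorem LB.mul (hf : LB s f K) (hg : LB s g L) : LB s (fun X => f X * g X) (2 * K * L) := by
  refine ⟨fun X hX => ?_, fun X hX Y hY => ?_⟩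
  · have h1 := hf.1 X hX
    have h2 := hg.1 X hX
    have hK := (abs_nonneg _).trans h1
    have hL := (abs_nonneg _).trans h2
    rw [abs_mul]
    have := mul_le_mul h1 h2 (abs_nonneg _) hK
    nlinarith [mul_nonneg hK hL]
  · have h1 := hf.1 X hX
    have h2 := hg.1 Y hY
    have h3 := hf.2 X hX Y hY
    have h4 := hg.2 X hX Y hY
    have hK := (abs_nonneg _).trans h1
    have hL := (abs_nonneg _).trans h2
    have : f X * g X - f Y * g Y = f X * (g X - g Y) + (f X - f Y) * g Y := by ring
    rw [this]
    refine (abs_add_le _ _).trans ?_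
    rw [abs_mul, abs_mul]
    have a1 := mul_le_mul h1 h4 (abs_nonneg _) hK
    have a2 := mul_le_mul h3 h2 (abs_nonneg _) ((abs_nonneg _).trans h3)
    nlinarith

theorem LB.pow2 (hf : LB s f K) : LB s (fun X => f X ^ 2) (2 * K ^ 2) := by
  have := hf.mul hf
  convert this using 1
  · ext; ring
  · ring
theorem LB.pow3 (hf : LB s f K) : LB s (fun X => f X ^ 3) (4 * K ^ 3) := by
  have := hf.pow2.mul hf
  convert this using 1
  · ext; ring
  · ring
theorem LB.pow4 (hf : LB s f K) : LB s (fun X => f X ^ 4) (8 * K ^ 4) := by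
  have := hf.pow3.mul hf
  convert this using 1
  · ext; ring
  · ring
theorem LB.pow5 (hf : LB s f K) : LB s (fun X => f X ^ 5) (16 * K ^ 5) := by
  have := hf.pow4.mul hf
  convert this using 1
  · ext; ring
  · ring

theorem LB.comp (hf : LB s f K) (φ : ℝ → ℝ) (c : ℝ) (hc : 0 ≤ c)
    (h1 : ∀ y, |y| ≤ K → |φ y| ≤ c * |y|)
    (h2 : ∀ y z, |y| ≤ K → |z| ≤ K → |φ y - φ z| ≤ c * |y - z|) :
    LB s (fun X => φ (f X)) (c * K) :=
  ⟨fun X hX => (h1 _ (hf.1 X hX)).trans (mul_le_mul_of_nonneg_left (hf.1 X hX) hc),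
   fun X hX Y hY => (h2 _ _ (hf.1 X hX) (hf.1 Y hY)).trans (by
    rw [mul_assoc]; exact mul_le_mul_of_nonneg_left (hf.2 X hX Y hY) hc)⟩

theorem LB.sum {F : ℕ → E → ℝ} {k : ℕ → ℝ} (h : ∀ j, LB s (F j) (k j)) (m : ℕ) :
    LB s (fun X => ∑ j ∈ Finset.range m, F j X) (∑ j ∈ Finset.range m, k j) := by
  induction m with
  | zero => simpa using (LB.const (s := s) 0)
  | succ m ih => simpa [Finset.sum_range_succ] using ih.add (h m)

theorem geo_sum_le {r : ℝ} (h0 : 0 ≤ r) (h1 : r ≤ 1 / 2) (m : ℕ) :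
    ∑ j ∈ Finset.range m, r ^ j ≤ 2 := by
  have h := Summable.sum_le_tsum (Finset.range m) (fun i _ => pow_nonneg h0 i)
    (summable_geometric_of_lt_one h0 (by linarith))
  rw [tsum_geometric_of_lt_one h0 (by linarith)] at h
  refine h.trans ?_
  rw [inv_le_comm₀ (by linarith) (by norm_num)]
  linarith

theorem LB.gsum {F : ℕ → E → ℝ} {c r : ℝ} (hc : 0 ≤ c) (h0 : 0 ≤ r) (h1 : r ≤ 1 / 2)
    (h : ∀ j, LB s (F j) (c * r ^ j)) (m : ℕ) :
    LB s (fun X => ∑ j ∈ Finset.range m, F j X) (2 * c) := by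
  refine (LB.sum h m).mono ?_
  rw [← Finset.mul_sum]
  nlinarith [geo_sum_le h0 h1 m]

theorem geo_summable {F : ℕ → ℝ} {c r : ℝ} (h0 : 0 ≤ r) (h1 : r ≤ 1 / 2)
    (h : ∀ j, |F j| ≤ c * r ^ j) : Summable F :=
  Summable.of_norm_bounded ((summable_geometric_of_lt_one h0 (by linarith)).mul_left c) h

theorem LB.gtsum {F : ℕ → E → ℝ} {c r : ℝ} (hc : 0 ≤ c) (h0 : 0 ≤ r) (h1 : r ≤ 1 / 2)
    (h : ∀ j, LB s (F j) (c * r ^ j)) :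
    LB s (fun X => ∑' j, F j X) (2 * c) := by
  have hs : ∀ X ∈ s, Summable (fun j => F j X) := fun X hX =>
    geo_summable h0 h1 fun j => (h j).1 X hX
  refine ⟨fun X hX => ?_, fun X hX Y hY => ?_⟩
  · refine le_of_tendsto ((hs X hX).hasSum.tendsto_sum_nat.abs) (Eventually.of_forall fun m => ?_)
    exact (LB.gsum hc h0 h1 h m).1 X hX
  · refine le_of_tendsto (((hs X hX).hasSum.tendsto_sum_nat.sub
      (hs Y hY).hasSum.tendsto_sum_nat).abs) (Eventually.of_forall fun m => ?_)
    exact (LB.gsum hc h0 h1 h m).2 X hX Y hY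

end LBsec

theorem fix_exists {ι : Type*} [TopologicalSpace ι] [DiscreteTopology ι]
    (f : ι → (ι →ᵇ ℝ) → ℝ) (hf : ∀ i, LB (closedBall (0 : ι →ᵇ ℝ) 1) (f i) (1 / 2)) :
    ∃ X ∈ closedBall (0 : ι →ᵇ ℝ) 1, ∀ i, X i = f i X := by
  set s := closedBall (0 : ι →ᵇ ℝ) 1 with hs
  let Φ : s → (ι →ᵇ ℝ) := fun X => BoundedContinuousFunction.ofNormedAddCommGroup
    (fun i => f i X) continuous_of_discreteTopology 1
    (fun i => ((hf i).1 X X.2).trans (by norm_num))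
  have hΦ : ∀ X, Φ X ∈ s := fun X => by
    rw [hs, mem_closedBall, dist_zero_right]
    exact BoundedContinuousFunction.norm_ofNormedAddCommGroup_le _ zero_le_one _
  let Ψ : s → s := fun X => ⟨Φ X, hΦ X⟩
  have hlip : ContractingWith (1 / 2) Ψ := by
    refine ⟨by rw [← NNReal.coe_lt_coe]; norm_num, LipschitzWith.of_dist_le_mul fun X Y => ?_⟩
    change dist (Φ X) (Φ Y) ≤ _
    refine (BoundedContinuousFunction.dist_le (by positivity)).2 fun i => ?_
    have := (hf i).2 X X.2 Y Y.2
    rw [Real.dist_eq]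
    simpa [Φ, Subtype.dist_eq] using this
  have : CompleteSpace s := isClosed_closedBall.completeSpace_coe
  have : Nonempty s := ⟨⟨0, by simp [hs]⟩⟩
  obtain ⟨X, hX⟩ : ∃ X, Function.IsFixedPt Ψ X := ⟨_, hlip.fixedPoint_isFixedPt⟩
  refine ⟨X, X.2, fun i => ?_⟩
  have h2 : Φ X = (X : ι →ᵇ ℝ) := congrArg Subtype.val hX
  conv_lhs => rw [← h2]
  rfl

theorem fix_exists_w {ι : Type*} [TopologicalSpace ι] [DiscreteTopology ι] (w : ι → ℝ)
    (hw : ∀ i, 0 < w i) (f : ι → (ι →ᵇ ℝ) → ℝ)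
    (hf : ∀ i, LB (closedBall (0 : ι →ᵇ ℝ) 1) (f i) (w i / 2)) :
    ∃ X ∈ closedBall (0 : ι →ᵇ ℝ) 1, ∀ i, w i * X i = f i X := by
  obtain ⟨X, hX, h⟩ := fix_exists (fun i X => (w i)⁻¹ * f i X) (fun i => by
    refine ((hf i).cmul (w i)⁻¹).mono (le_of_eq ?_)
    have := hw i
    rw [abs_of_pos (inv_pos.2 this)]
    field_simp)
  refine ⟨X, hX, fun i => ?_⟩
  rw [h i, mul_inv_cancel_left₀ (hw i).ne']

theorem LB.coord {ι : Type*} [TopologicalSpace ι] (i : ι) :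
    LB (closedBall (0 : ι →ᵇ ℝ) 1) (fun X => X i) 1 := by
  refine ⟨fun X hX => ?_, fun X _ Y _ => ?_⟩
  · rw [mem_closedBall, dist_zero_right] at hX
    exact (X.norm_coe_le_norm i).trans hX
  · rw [one_mul, ← Real.dist_eq]
    exact BoundedContinuousFunction.dist_coe_le_dist i

theorem rpow_lip_pos {q K y z : ℝ} (hq : 0 < q) (hy : 0 ≤ y) (hz : 0 ≤ z) (hyK : y ≤ K)
    (hzK : z ≤ K) : |y ^ q * y - z ^ q * z| ≤ (q + 1) * K ^ q * |y - z| := by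
  have key : ∀ t : ℝ, 0 ≤ t → t ^ q * t = t ^ (q + 1) := fun t ht => by
    rw [Real.rpow_add' ht (by linarith), Real.rpow_one]
  rw [key y hy, key z hz]
  have := (convex_Icc (0:ℝ) K).norm_image_sub_le_of_norm_hasDerivWithin_le
    (f := fun t => t ^ (q + 1)) (f' := fun t => (q + 1) * t ^ (q + 1 - 1)) (C := (q + 1) * K ^ q)
    (fun t _ => (Real.hasDerivAt_rpow_const (Or.inr (by linarith))).hasDerivWithinAt)
    (fun t ht => by
      rw [add_sub_cancel_right, Real.norm_eq_abs, abs_of_nonneg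
        (mul_nonneg (by linarith) (Real.rpow_nonneg ht.1 _))]
      exact mul_le_mul_of_nonneg_left (Real.rpow_le_rpow ht.1 ht.2 hq.le) (by linarith))
    (show z ∈ Icc 0 K from ⟨hz, hzK⟩) (show y ∈ Icc 0 K from ⟨hy, hyK⟩)
  simpa using this

theorem abs_rpow_mul_le {q K y : ℝ} (hq : 0 < q) (hy : |y| ≤ K) :
    |(|y| ^ q * y)| ≤ K ^ q * |y| := by
  rw [abs_mul, abs_of_nonneg (Real.rpow_nonneg (abs_nonneg y) q)]
  exact mul_le_mul_of_nonneg_right (Real.rpow_le_rpow (abs_nonneg _) hy hq.le) (abs_nonneg _)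

theorem rpow_lip {q K y z : ℝ} (hq : 0 < q) (hy : |y| ≤ K) (hz : |z| ≤ K) :
    |(|y| ^ q * y - |z| ^ q * z)| ≤ (q + 1) * K ^ q * |y - z| := by
  have hK : 0 ≤ K := (abs_nonneg _).trans hy
  have hKq : 0 ≤ K ^ q := Real.rpow_nonneg hK q
  have opp : |y - z| = |y| + |z| →
      |(|y| ^ q * y - |z| ^ q * z)| ≤ (q + 1) * K ^ q * |y - z| := fun h => by
    rw [h]
    refine (abs_sub _ _).trans ?_
    have h1 := abs_rpow_mul_le hq hy
    have h2 := abs_rpow_mul_le hq hz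
    have h3 : 0 ≤ q * K ^ q * (|y| + |z|) := by positivity
    nlinarith
  rcases le_total 0 y with h1 | h1 <;> rcases le_total 0 z with h2 | h2
  · rw [abs_of_nonneg h1] at hy ⊢
    rw [abs_of_nonneg h2] at hz ⊢
    exact rpow_lip_pos hq h1 h2 hy hz
  · exact opp (by rw [abs_of_nonneg h1, abs_of_nonpos h2, abs_of_nonneg] <;> linarith)
  · exact opp (by rw [abs_of_nonpos h1, abs_of_nonneg h2, abs_of_nonpos] <;> linarith)
  · rw [abs_of_nonpos h1] at hy ⊢
    rw [abs_of_nonpos h2] at hz ⊢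
    have := rpow_lip_pos hq (neg_nonneg.2 h1) (neg_nonneg.2 h2) hy hz
    rw [abs_sub_comm y z, ← abs_neg]
    convert this using 2 <;> ring_nf

theorem rpow_lip_one {q y z : ℝ} (hq : 0 < q) (hy : |y| ≤ 1 / 2) (hz : |z| ≤ 1 / 2) :
    |(|1 + y| ^ q - |1 + z| ^ q)| ≤ q * (2 * 2 ^ q) * |y - z| := by
  rw [abs_le] at hy hz
  rw [abs_of_nonneg (by linarith : 0 ≤ 1 + y), abs_of_nonneg (by linarith : 0 ≤ 1 + z)]
  have := (convex_Icc (1/2:ℝ) 2).norm_image_sub_le_of_norm_hasDerivWithin_le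
    (f := fun t => t ^ q) (f' := fun t => q * t ^ (q - 1)) (C := q * (2 * 2 ^ q))
    (fun t ht => (Real.hasDerivAt_rpow_const (Or.inl (by linarith [ht.1]))).hasDerivWithinAt)
    (fun t ht => by
      have ht0 : 0 < t := by linarith [ht.1]
      rw [Real.norm_eq_abs, abs_of_nonneg (mul_nonneg hq.le (Real.rpow_nonneg ht0.le _))]
      refine mul_le_mul_of_nonneg_left ?_ hq.le
      rw [Real.rpow_sub_one ht0.ne', div_le_iff₀ ht0]
      have h1 := Real.rpow_le_rpow ht0.le ht.2 hq.le
      have h2 : (0:ℝ) < 2 ^ q := by positivity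
      nlinarith [ht.1])
    (show 1 + z ∈ Icc (1/2:ℝ) 2 from ⟨by linarith, by linarith⟩)
    (show 1 + y ∈ Icc (1/2:ℝ) 2 from ⟨by linarith, by linarith⟩)
  simpa using this


set_option maxHeartbeats 4000000 in
theorem core (q C σ τ ε μ x e b : ℝ) (hq : 0 < q) (hC : 1 ≤ C)
    (hσ0 : 0 < σ) (hσ : σ ≤ 1 / 100) (hCσ : C * σ ≤ 1 / 1000)
    (hτ0 : 0 < τ) (hτ : (C + 1) * (q * (2 * 2 ^ q) + 1) * τ ≤ σ / 1000)
    (hε0 : 0 < ε) (hε1 : ε * ((q + 1) * 2 ^ q) ≤ 1 / 100) (hε2 : ε * (q * (2 * 2 ^ q)) ≤ 1 / 100)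
    (hμ0 : 0 < μ) (hμ : μ ≤ τ * σ / 1000)
    (hx : |x| ≤ σ ^ 2 / 10000) (hxq : (C + 1) * ((q + 1) * 2 ^ q) * |x| ^ q ≤ σ / 100)
    (he : e = 1 + b) (hbC : |b| ≤ C) (hb8 : b ≤ 1 / 8) :
    ∃ a l : ℕ → ℝ, |a 0 - 1| ≤ τ ∧ (∀ j, |a (j + 1)| ≤ τ * σ ^ (j + 1)) ∧
      (∀ j, |l j| ≤ 2 * σ ^ j) ∧
      (a 0 - 1 = -(1 / 4) * (6 * (a 0 - 1) ^ 2 + 4 * (a 0 - 1) ^ 3 + (a 0 - 1) ^ 4)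
        + (-(1 / 4)) * ((∑' j, a (1 + j) ^ 4) + ε * (|a 0| ^ q - 1) - 2 * μ
            + μ * ((a 1 + x * l 0) * (a 0)⁻¹))) ∧
      (∀ j, a (j + 1) = (1 / (1 + ε + 2 * μ)) * (μ * (a (j + 2) + a j)
        + (∑' i, a (j + 1 + i) ^ 4) * a (j + 1) + ε * (|a (j + 1)| ^ q * a (j + 1)))) ∧
      (l 0 - 1 = -(b / (4 * b - 1)) * (10 * (l 0 - 1) ^ 2 + 10 * (l 0 - 1) ^ 3
          + 5 * (l 0 - 1) ^ 4 + (l 0 - 1) ^ 5)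
        + (-(1 / (4 * b - 1))) * ((a 0 - 1) + x * l 1 - e * ((|a 0| ^ q - 1) * l 0)
          - x * (((a 1 + x * l 0) * (a 0)⁻¹) * l 0) + (e * |x| ^ q) * (|l 0| ^ q * l 0))) ∧
      (∀ j, l (j + 1) = x * (l j + l (j + 2)) - e * ((|a 0| ^ q - 1) * l (j + 1))
          - x * (((a 1 + x * l 0) * (a 0)⁻¹) * l (j + 1))
          + b * (((l 0 ^ 4 - 1) + ∑ i ∈ Finset.range (j + 1), l (i + 1) ^ 4) * l (j + 1))
          + (e * |x| ^ q) * (|l (j + 1)| ^ q * l (j + 1))) := by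
  have e2 : σ ^ 2 ≤ σ / 100 := by nlinarith
  have e3 : σ ^ 3 ≤ σ / 10000 := by
    have := mul_le_mul_of_nonneg_right e2 hσ0.le
    have h : σ ^ 3 = σ ^ 2 * σ := by ring
    linarith
  have e4 : σ ^ 4 ≤ σ / 1000000 := by
    have := mul_le_mul_of_nonneg_right e3 hσ0.le
    have h : σ ^ 4 = σ ^ 3 * σ := by ring
    linarith
  have e5 : σ ^ 5 ≤ σ / 1000000 := by
    have := mul_le_mul_of_nonneg_right e4 hσ0.le
    have h : σ ^ 5 = σ ^ 4 * σ := by ring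
    linarith
  have h2q : (1:ℝ) ≤ 2 ^ q := Real.one_le_rpow (by norm_num) hq.le
  set cp : ℝ := q * (2 * 2 ^ q) with hcp
  set N : ℝ := (q + 1) * 2 ^ q with hN
  have hcp0 : 0 ≤ cp := by positivity
  have hN0 : 0 ≤ N := by positivity
  have hN1 : (2:ℝ) ^ q ≤ N := by rw [hN]; nlinarith
  have hCcp : 0 ≤ (C + 1) * cp := by positivity
  have hτσ : τ ≤ σ / 1000 := by nlinarith [mul_nonneg hCcp hτ0.le, mul_pos (by linarith : 0 < C) hτ0]
  have hτcp : (C + 1) * cp * τ ≤ σ / 1000 := by nlinarith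
  have hτ1 : τ ≤ 1 / 100000 := by linarith
  have heC : |e| ≤ C + 1 := by
    rw [he]; exact (abs_add_le _ _).trans (by rw [abs_one]; linarith)
  have hxs : |x| ≤ 1 / 100000000 := by linarith
  let E := (ℕ ⊕ ℕ) →ᵇ ℝ
  let s : Set E := closedBall 0 1
  let A : ℕ → E → ℝ := fun j X => (if j = 0 then 1 else 0) + τ * σ ^ j * X (Sum.inl j)
  let L : ℕ → E → ℝ := fun j X => (if j = 0 then 1 else 0) + σ ^ (j + 1) * X (Sum.inr j)
  have hpow : ∀ j : ℕ, 0 < σ ^ j := fun j => pow_pos hσ0 j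
  have hpow1 : ∀ j : ℕ, σ ^ j ≤ 1 := fun j => pow_le_one₀ hσ0.le (by linarith)
  have hτσj : ∀ j : ℕ, τ * σ ^ j ≤ 1 := fun j =>
    (mul_le_of_le_one_right hτ0.le (hpow1 j)).trans (by linarith)
  have hA1 : ∀ j, LB s (A (j + 1)) (τ * σ ^ (j + 1)) := fun j => by
    have := (LB.coord (ι := ℕ ⊕ ℕ) (Sum.inl (j + 1))).cmul (τ * σ ^ (j + 1))
    rw [abs_of_pos (by positivity), mul_one] at this
    simpa [A] using this
  have hAt : LB s (fun X => A 0 X - 1) τ := by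
    have := (LB.coord (ι := ℕ ⊕ ℕ) (Sum.inl 0)).cmul τ
    rw [abs_of_pos (by positivity), mul_one] at this
    simpa [A] using this
  have hA0 : LB s (A 0) 2 := by
    have := (hAt.add (LB.const (s := s) 1)).mono (by rw [abs_one]; linarith : τ + |1| ≤ 2)
    simpa using this
  have hA : ∀ j, LB s (A j) (2 * σ ^ j) := fun j => by
    rcases j with _ | j
    · simpa using hA0
    · refine (hA1 j).mono ?_
      have := mul_le_mul_of_nonneg_right (hτ1.trans (by norm_num : (1:ℝ)/100000 ≤ 2)) (hpow (j + 1)).le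
      linarith
  have hL1 : ∀ j, LB s (L (j + 1)) (σ ^ (j + 2)) := fun j => by
    have := (LB.coord (ι := ℕ ⊕ ℕ) (Sum.inr (j + 1))).cmul (σ ^ (j + 2))
    rw [abs_of_pos (by positivity), mul_one] at this
    simpa [L] using this
  have hLt : LB s (fun X => L 0 X - 1) σ := by
    have := (LB.coord (ι := ℕ ⊕ ℕ) (Sum.inr 0)).cmul σ
    rw [abs_of_pos (by positivity), mul_one] at this
    simpa [L] using this
  have hL0 : LB s (L 0) 2 := by
    have := (hLt.add (LB.const (s := s) 1)).mono (by rw [abs_one]; linarith : σ + |1| ≤ 2)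
    simpa using this
  have hL : ∀ j, LB s (L j) (2 * σ ^ j) := fun j => by
    rcases j with _ | j
    · simpa using hL0
    · refine (hL1 j).mono ?_
      have := mul_le_mul_of_nonneg_right (hσ.trans (by norm_num : (1:ℝ)/100 ≤ 2)) (hpow (j + 1)).le
      have h2 : σ ^ (j + 2) = σ * σ ^ (j + 1) := by ring
      linarith
  -- the gauge tail
  have hS : ∀ j, LB s (fun X => ∑' i, A (j + 1 + i) X ^ 4) (16 * τ ^ 4) := fun j => by
    refine (LB.gtsum (c := 8 * τ ^ 4) (r := σ) (by positivity) hσ0.le (by linarith)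
      fun i => ?_).mono (by linarith)
    have h1 := (hA1 (j + i)).pow4
    have h2 : j + i + 1 = j + 1 + i := by ring
    rw [h2] at h1
    refine h1.mono ?_
    have h3 : σ ^ (j + 1 + i) ≤ σ ^ i := by
      rw [pow_add]; exact mul_le_of_le_one_left (hpow i).le (hpow1 _)
    have h4 : (σ ^ (j + 1 + i)) ^ 4 ≤ σ ^ (j + 1 + i) :=
      pow_le_of_le_one (hpow _).le (hpow1 _) (by norm_num)
    have : 8 * (τ * σ ^ (j + 1 + i)) ^ 4 = 8 * τ ^ 4 * (σ ^ (j + 1 + i)) ^ 4 := by ring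
    rw [this]
    exact mul_le_mul_of_nonneg_left (h4.trans h3) (by positivity)
  have hP : LB s (fun X => |A 0 X| ^ q - 1) (cp * τ) := by
    have := hAt.comp (fun t => |1 + t| ^ q - 1) cp hcp0
      (fun y hy => by
        have := rpow_lip_one hq (hy.trans (by linarith)) (show |(0:ℝ)| ≤ 1/2 by norm_num)
        simpa using this)
      (fun y z hy hz => by
        have := rpow_lip_one hq (hy.trans (by linarith)) (hz.trans (by linarith : τ ≤ 1/2))
        simpa using this)
    simpa using this
  have hI : LB s (fun X => (A 0 X)⁻¹) 4 := by
    have hlow : ∀ X ∈ s, 1 / 2 ≤ A 0 X := fun X hX => by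
      have := abs_le.1 (hAt.1 X hX); linarith
    have hinv : ∀ X ∈ s, |(A 0 X)⁻¹| ≤ 2 := fun X hX => by
      have := hlow X hX
      rw [abs_of_pos (inv_pos.2 (by linarith)), inv_le_comm₀ (by linarith) (by norm_num)]
      linarith
    refine ⟨fun X hX => (hinv X hX).trans (by norm_num), fun X hX Y hY => ?_⟩
    have h1 := hlow X hX
    have h2 := hlow Y hY
    have h3 := hAt.2 X hX Y hY
    have h5 : A 0 X - 1 - (A 0 Y - 1) = A 0 X - A 0 Y := by ring
    rw [h5] at h3
    have h4 : (A 0 X)⁻¹ - (A 0 Y)⁻¹ = -((A 0 X)⁻¹ * (A 0 Y)⁻¹ * (A 0 X - A 0 Y)) := by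
      have : A 0 X ≠ 0 := by linarith
      have : A 0 Y ≠ 0 := by linarith
      field_simp; ring
    rw [h4, abs_neg, abs_mul, abs_mul]
    have h6 : |(A 0 X)⁻¹| * |(A 0 Y)⁻¹| ≤ 2 * 2 :=
      mul_le_mul (hinv X hX) (hinv Y hY) (abs_nonneg _) (by norm_num)
    have h7 : τ * dist X Y ≤ 1 * dist X Y := mul_le_mul_of_nonneg_right (by linarith) dist_nonneg
    have h8 := mul_le_mul h6 (h3.trans h7) (abs_nonneg _) (by norm_num)
    linarith
  have hQ : LB s (fun X => (A 1 X + x * L 0 X) * (A 0 X)⁻¹) 24 := by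
    refine (((hA1 0).add (hL0.cmul x)).mul hI).mono ?_
    have := hτσj (0 + 1)
    linarith
  have hpq : ∀ (f : E → ℝ) (K : ℝ), K ≤ 2 → LB s f K →
      LB s (fun X => |f X| ^ q * f X) (N * K) := fun f K hK2 hf => by
    refine hf.comp (fun t => |t| ^ q * t) N hN0 (fun y hy => ?_) (fun y z hy hz => ?_)
    · exact (abs_rpow_mul_le hq (hy.trans hK2)).trans
        (mul_le_mul_of_nonneg_right hN1 (abs_nonneg _))
    · exact rpow_lip hq (hy.trans hK2) (hz.trans hK2)
  have hT : ∀ j, LB s (fun X => (L 0 X ^ 4 - 1) + ∑ i ∈ Finset.range (j + 1), L (i + 1) X ^ 4)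
      (6 * σ) := fun j => by
    have h1 := (((hLt.cmul 4).add (hLt.pow2.cmul 6)).add (hLt.pow3.cmul 4)).add hLt.pow4
    have h2 : LB s (fun X => ∑ i ∈ Finset.range (j + 1), L (i + 1) X ^ 4) (2 * (8 * σ ^ 2)) :=
      LB.gsum (by positivity) hσ0.le (by linarith) (fun i => by
        refine (hL1 i).pow4.mono ?_
        have h4 : (σ ^ (i + 2)) ^ 4 ≤ σ ^ (i + 2) :=
          pow_le_of_le_one (hpow _).le (hpow1 _) (by norm_num)
        have : 8 * σ ^ 2 * σ ^ i = 8 * σ ^ (i + 2) := by ring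
        linarith) _
    have h3 := h1.add h2
    have h4 : (fun X => (L 0 X ^ 4 - 1) + ∑ i ∈ Finset.range (j + 1), L (i + 1) X ^ 4)
      = (fun X => 4 * (L 0 X - 1) + 6 * (L 0 X - 1) ^ 2 + 4 * (L 0 X - 1) ^ 3 + (L 0 X - 1) ^ 4
          + ∑ i ∈ Finset.range (j + 1), L (i + 1) X ^ 4) := by
      ext X; ring
    rw [h4]
    refine h3.mono ?_
    norm_num
    linarith
  let w : ℕ ⊕ ℕ → ℝ := Sum.elim (fun j => τ * σ ^ j) (fun j => σ ^ (j + 1))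
  let fR : ℕ → E → ℝ := fun j => match j with
    | 0 => fun X => -(1 / 4) * (6 * (A 0 X - 1) ^ 2 + 4 * (A 0 X - 1) ^ 3 + (A 0 X - 1) ^ 4)
        + (-(1 / 4)) * ((∑' j, A (1 + j) X ^ 4) + ε * (|A 0 X| ^ q - 1) - 2 * μ
            + μ * ((A 1 X + x * L 0 X) * (A 0 X)⁻¹))
    | j + 1 => fun X => (1 / (1 + ε + 2 * μ)) * (μ * (A (j + 2) X + A j X)
        + (∑' i, A (j + 1 + i) X ^ 4) * A (j + 1) X + ε * (|A (j + 1) X| ^ q * A (j + 1) X))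
  let fL : ℕ → E → ℝ := fun j => match j with
    | 0 => fun X => -(b / (4 * b - 1)) * (10 * (L 0 X - 1) ^ 2 + 10 * (L 0 X - 1) ^ 3
          + 5 * (L 0 X - 1) ^ 4 + (L 0 X - 1) ^ 5)
        + (-(1 / (4 * b - 1))) * ((A 0 X - 1) + x * L 1 X - e * ((|A 0 X| ^ q - 1) * L 0 X)
          - x * (((A 1 X + x * L 0 X) * (A 0 X)⁻¹) * L 0 X) + (e * |x| ^ q) * (|L 0 X| ^ q * L 0 X))
    | j + 1 => fun X => x * (L j X + L (j + 2) X) - e * ((|A 0 X| ^ q - 1) * L (j + 1) X)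
          - x * (((A 1 X + x * L 0 X) * (A 0 X)⁻¹) * L (j + 1) X)
          + b * (((L 0 X ^ 4 - 1) + ∑ i ∈ Finset.range (j + 1), L (i + 1) X ^ 4) * L (j + 1) X)
          + (e * |x| ^ q) * (|L (j + 1) X| ^ q * L (j + 1) X)
  have hxq0 : 0 ≤ |x| ^ q := Real.rpow_nonneg (abs_nonneg _) _
  have heq0 : |e * |x| ^ q| * N ≤ σ / 100 := by
    rw [abs_mul, abs_of_nonneg hxq0]
    refine le_trans ?_ hxq
    have := mul_le_mul_of_nonneg_right heC (mul_nonneg hN0 hxq0)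
    linarith
  have hecp : |e| * (cp * τ) ≤ σ / 1000 := by
    have := mul_le_mul_of_nonneg_right heC (mul_nonneg hcp0 hτ0.le)
    linarith
  have hbσ : |b| * σ ≤ 1 / 1000 :=
    (mul_le_mul_of_nonneg_right hbC hσ0.le).trans hCσ
  have hR0 : LB s (fR 0) (τ / 2) := by
    refine (((((hAt.pow2.cmul 6).add (hAt.pow3.cmul 4)).add hAt.pow4).cmul (-(1/4))).add
      (((((hS 0).add (hP.cmul ε)).sub (LB.const (2 * μ))).add (hQ.cmul μ)).cmul (-(1/4)))).mono ?_
    rw [abs_of_pos hε0, abs_of_pos hμ0, abs_of_pos (by positivity : 0 < 2 * μ)]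
    norm_num
    have e2 : τ ^ 2 ≤ τ / 1000 := by nlinarith only [hτ0, hτ1]
    have e3 : τ ^ 3 ≤ τ ^ 2 := pow_le_pow_of_le_one hτ0.le (by linarith) (by norm_num)
    have e4 : τ ^ 4 ≤ τ ^ 2 := pow_le_pow_of_le_one hτ0.le (by linarith) (by norm_num)
    have e5 : ε * (cp * τ) ≤ τ / 100 := by
      have := mul_le_mul_of_nonneg_right hε2 hτ0.le
      linarith
    have e6 : μ ≤ τ / 1000 := by
      have := mul_le_mul_of_nonneg_left hσ hτ0.le
      linarith
    linarith
  have hR1 : ∀ j, LB s (fR (j + 1)) (τ * σ ^ (j + 1) / 2) := fun j => by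
    have hw : τ * σ ^ (j + 1) ≤ 2 := by linarith [hτσj (j + 1)]
    refine (((((hA (j+2)).add (hA j)).cmul μ).add ((hS j).mul (hA1 j))).add
      ((hpq _ _ hw (hA1 j)).cmul ε)).cmul (1 / (1 + ε + 2 * μ)) |>.mono ?_
    rw [abs_of_pos hε0, abs_of_pos hμ0, abs_of_pos (by positivity : 0 < 1 / (1 + ε + 2 * μ))]
    have hw0 : 0 < τ * σ ^ (j + 1) := by positivity
    have e1 : μ * (2 * σ ^ (j + 2) + 2 * σ ^ j) ≤ τ * σ ^ (j + 1) / 100 := by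
      have h1 : σ ^ (j + 2) ≤ σ ^ j := pow_le_pow_of_le_one hσ0.le (by linarith) (by omega)
      have h2 := mul_le_mul_of_nonneg_right hμ (hpow j).le
      have h3 := mul_le_mul_of_nonneg_left h1 hμ0.le
      have h4 : τ * σ ^ (j + 1) = τ * σ * σ ^ j := by ring
      rw [h4]
      linarith
    have e4 : τ ^ 4 ≤ 1 / 1000 := by
      have : τ ^ 4 ≤ τ := pow_le_of_le_one hτ0.le (by linarith) (by norm_num)
      linarith
    have e5 : 2 * (16 * τ ^ 4) * (τ * σ ^ (j + 1)) ≤ τ * σ ^ (j + 1) / 10 := by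
      have := mul_le_mul_of_nonneg_right e4 hw0.le
      linarith
    have e6 : ε * (N * (τ * σ ^ (j + 1))) ≤ τ * σ ^ (j + 1) / 100 := by
      have := mul_le_mul_of_nonneg_right hε1 hw0.le
      linarith
    have e7 : 1 / (1 + ε + 2 * μ) ≤ 1 := by
      rw [div_le_one (by positivity)]; linarith
    refine (mul_le_of_le_one_left (by positivity) e7).trans ?_
    linarith
  have hL0' : LB s (fL 0) (σ / 2) := by
    refine ((((((hLt.pow2.cmul 10).add (hLt.pow3.cmul 10)).add (hLt.pow4.cmul 5)).add
      hLt.pow5).cmul (-(b / (4 * b - 1)))).add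
      ((((((hAt.add ((hL1 0).cmul x)).sub ((hP.mul hL0).cmul e)).sub ((hQ.mul hL0).cmul x)).add
        ((hpq _ _ le_rfl hL0).cmul (e * |x| ^ q))).cmul (-(1 / (4 * b - 1)))))).mono ?_
    have d1 : |-(1 / (4 * b - 1))| ≤ 2 := by
      rw [abs_neg, abs_div, abs_one, abs_of_neg (by linarith : 4 * b - 1 < 0),
        div_le_iff₀ (by linarith)]
      linarith
    have d2 : |-(b / (4 * b - 1))| ≤ 1 := by
      rw [abs_neg, abs_div, abs_of_neg (by linarith : 4 * b - 1 < 0),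
        div_le_iff₀ (by linarith), abs_le]
      constructor <;> linarith
    have f1 := mul_le_mul_of_nonneg_right d2
      (by positivity : 0 ≤ |(10:ℝ)| * (2 * σ ^ 2) + |10| * (4 * σ ^ 3) + |5| * (8 * σ ^ 4) + 16 * σ ^ 5)
    have f2 := mul_le_mul_of_nonneg_right d1
      (by positivity : 0 ≤ τ + |x| * σ ^ (0 + 2) + |e| * (2 * (cp * τ) * 2) + |x| * (2 * 24 * 2) +
        |e * |x| ^ q| * (N * 2))
    have e6 : |x| * σ ^ (0 + 2) ≤ |x| := mul_le_of_le_one_right (abs_nonneg _) (hpow1 _)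
    refine (add_le_add f1 f2).trans ?_
    have g1 : |x| ≤ σ / 10000 := by linarith
    have a10 : |(10:ℝ)| = 10 := by norm_num
    have a5 : |(5:ℝ)| = 5 := by norm_num
    rw [a10, a5]
    rw [zero_add] at e6 ⊢
    have k1 : 1 * (10 * (2 * σ ^ 2) + 10 * (4 * σ ^ 3) + 5 * (8 * σ ^ 4) + 16 * σ ^ 5) ≤ σ / 4 := by
      linarith
    have k2 : |e| * (2 * (cp * τ) * 2) ≤ σ / 100 := by linarith
    have k3 : |e * |x| ^ q| * (N * 2) ≤ σ / 50 := by linarith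
    linarith
  have hL1' : ∀ j, LB s (fL (j + 1)) (σ ^ (j + 2) / 2) := fun j => by
    have hw : σ ^ (j + 2) ≤ 2 := by linarith [hpow1 (j + 2)]
    refine ((((((hL j).add (hL (j + 2))).cmul x).sub ((hP.mul (hL1 j)).cmul e)).sub
      ((hQ.mul (hL1 j)).cmul x)).add (((hT j).mul (hL1 j)).cmul b)).add
      ((hpq _ _ hw (hL1 j)).cmul (e * |x| ^ q)) |>.mono ?_
    have hw0 := hpow (j + 2)
    have e1 : |x| * (2 * σ ^ j + 2 * σ ^ (j + 2)) ≤ σ ^ (j + 2) / 100 := by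
      have h1 : σ ^ (j + 2) ≤ σ ^ j := pow_le_pow_of_le_one hσ0.le (by linarith) (by omega)
      have h2 := mul_le_mul_of_nonneg_right hx (hpow j).le
      have h3 := mul_le_mul_of_nonneg_left h1 (abs_nonneg x)
      have h4 : σ ^ (j + 2) = σ ^ 2 * σ ^ j := by ring
      linarith
    have e2 : |e| * (2 * (cp * τ) * σ ^ (j + 2)) ≤ σ ^ (j + 2) / 100 := by
      have := mul_le_mul_of_nonneg_right (hecp.trans (by linarith : σ / 1000 ≤ 1 / 200)) hw0.le
      linarith
    have e3 : |x| * (2 * 24 * σ ^ (j + 2)) ≤ σ ^ (j + 2) / 100 := by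
      have := mul_le_mul_of_nonneg_right hxs hw0.le
      linarith
    have e4 : |b| * (2 * (6 * σ) * σ ^ (j + 2)) ≤ σ ^ (j + 2) / 10 := by
      have := mul_le_mul_of_nonneg_right hbσ hw0.le
      linarith
    have e5 : |e * |x| ^ q| * (N * σ ^ (j + 2)) ≤ σ ^ (j + 2) / 100 := by
      have := mul_le_mul_of_nonneg_right (heq0.trans (by linarith : σ / 100 ≤ 1 / 100)) hw0.le
      linarith
    linarith
  obtain ⟨X, hX, hfix⟩ := fix_exists_w w (by rintro (j | j) <;> simp [w] <;> positivity)
    (Sum.elim fR fL) (by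
      rintro (j | j)
      · rcases j with _ | j
        · simpa [w] using hR0
        · simpa [w] using hR1 j
      · rcases j with _ | j
        · simpa [w] using hL0'
        · simpa [w] using hL1' j)
  refine ⟨fun j => A j X, fun j => L j X, hAt.1 X hX, fun j => (hA1 j).1 X hX,
    fun j => (hL j).1 X hX, ?_, fun j => ?_, ?_, fun j => ?_⟩
  · have := hfix (Sum.inl 0)
    refine Eq.trans ?_ this
    simp [A, w]
  · have := hfix (Sum.inl (j + 1))
    refine Eq.trans ?_ this
    simp [A, w]
  · have := hfix (Sum.inr 0)
    refine Eq.trans ?_ this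
    simp [L, w]
  · have := hfix (Sum.inr (j + 1))
    refine Eq.trans ?_ this
    simp [L, w]

theorem gauge_step (F : ℤ → ℝ) (hF : Summable F) (n : ℤ) :
    (∑' k : ℤ, if n ≤ k then F k else 0) = F n + ∑' k : ℤ, if n + 1 ≤ k then F k else 0 := by
  have h1 : (fun k : ℤ => if n ≤ k then F k else 0)
      = fun k => (if k = n then F n else 0) + (if n + 1 ≤ k then F k else 0) := by
    ext k
    rcases lt_trichotomy k n with h | h | h
    · rw [if_neg (by omega), if_neg (by omega), if_neg (by omega), add_zero]
    · subst h; rw [if_pos le_rfl, if_pos rfl, if_neg (by omega), add_zero]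
    · rw [if_pos (by omega), if_neg (by omega), if_pos (by omega), zero_add]
  rw [h1, Summable.tsum_add, tsum_ite_eq]
  · exact (hasSum_ite_eq n (F n)).summable
  · have := hF.indicator {k : ℤ | n + 1 ≤ k}
    refine this.congr fun k => ?_
    simp [Set.indicator]

theorem gauge_nat (F : ℤ → ℝ) (m : ℕ) :
    (∑' k : ℤ, if (m : ℤ) ≤ k then F k else 0) = ∑' i : ℕ, F ((m + i : ℕ) : ℤ) := by
  have hinj : Function.Injective (fun i : ℕ => ((m + i : ℕ) : ℤ)) := fun i j h => by
    simp at h; exact h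
  rw [← hinj.tsum_eq (f := fun k : ℤ => if (m : ℤ) ≤ k then F k else 0)]
  · refine tsum_congr fun i => ?_
    rw [if_pos (by push_cast; omega)]
  · intro k hk
    rw [Function.mem_support] at hk
    have : (m : ℤ) ≤ k := by by_contra h; simp [h] at hk
    exact ⟨(k - m).toNat, by simp; omega⟩

theorem normalized (q C σ τ ε μ x b : ℝ) (hq : 0 < q) (hC : 1 ≤ C)
    (hσ0 : 0 < σ) (hσ : σ ≤ 1 / 100) (hCσ : C * σ ≤ 1 / 1000)
    (hτ0 : 0 < τ) (hτ : (C + 1) * (q * (2 * 2 ^ q) + 1) * τ ≤ σ / 1000)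
    (hε0 : 0 < ε) (hε1 : ε * ((q + 1) * 2 ^ q) ≤ 1 / 100) (hε2 : ε * (q * (2 * 2 ^ q)) ≤ 1 / 100)
    (hμ0 : 0 < μ) (hμ : μ ≤ τ * σ / 1000)
    (hx : |x| ≤ σ ^ 2 / 10000) (hxq : (C + 1) * ((q + 1) * 2 ^ q) * |x| ^ q ≤ σ / 100)
    (hbC : |b| ≤ C) (hb8 : b ≤ 1 / 8) (hxb : x ^ 5 = b * μ) (hxe : ε * x = (1 + b) * μ)
    (hτ2 : τ ≤ 1 / 2) :
    ∃ V : ℤ → ℝ, Summable (fun n => |V n|) ∧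
      (∀ n : ℤ, μ * (V (n + 1) - 2 * V n + V (n - 1)) - (1 + ε) * V n
        + (∑' k : ℤ, if n ≤ k then V k ^ 4 else 0) * V n + ε * |V n| ^ q * V n = 0) ∧
      (∑' n, |V n - deltaSeq n|) ≤ 2 * τ + 4 * |x| := by
  obtain ⟨a, l, h0, hr, hl, e0, er, f0, fl⟩ := core q C σ τ ε μ x (1 + b) b hq hC hσ0 hσ hCσ hτ0 hτ
    hε0 hε1 hε2 hμ0 hμ hx hxq rfl hbC hb8
  let V : ℤ → ℝ := fun n => match n with
    | Int.ofNat j => a j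
    | Int.negSucc j => x * l j
  have Vn : ∀ j : ℕ, V (j : ℤ) = a j := fun j => rfl
  have Vs : ∀ j : ℕ, V (Int.negSucc j) = x * l j := fun j => rfl
  have hgeo : HasSum (fun j : ℕ => σ ^ j) (1 - σ)⁻¹ :=
    hasSum_geometric_of_lt_one hσ0.le (by linarith)
  have hg2 : (1 - σ)⁻¹ ≤ 2 := by
    rw [inv_le_comm₀ (by linarith) (by norm_num)]; linarith
  have hD : HasSum (fun n : ℤ => Int.rec (motive := fun _ => ℝ) (fun j => τ * σ ^ j)
      (fun j => |x| * (2 * σ ^ j)) n) (τ * (1 - σ)⁻¹ + |x| * (2 * (1 - σ)⁻¹)) :=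
    HasSum.int_rec (hgeo.mul_left τ) ((hgeo.mul_left 2).mul_left |x|)
  have hle : ∀ n : ℤ, |V n - deltaSeq n| ≤ Int.rec (motive := fun _ => ℝ) (fun j => τ * σ ^ j)
      (fun j => |x| * (2 * σ ^ j)) n := by
    rintro (j | j)
    · rcases j with _ | j
      · simpa [V, deltaSeq] using h0
      · have h := hr j
        have h2 : deltaSeq (Int.ofNat (j + 1)) = 0 := by
          simp only [deltaSeq, Int.ofNat_eq_natCast]; rw [if_neg]; omega
        rw [h2, sub_zero]; exact h
    · have h2 : deltaSeq (Int.negSucc j) = 0 := by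
        simp [deltaSeq]
      rw [h2, sub_zero, Vs, abs_mul]
      exact mul_le_mul_of_nonneg_left (hl j) (abs_nonneg _)
  have hsd : Summable (fun n => V n - deltaSeq n) := Summable.of_norm_bounded hD.summable hle
  have hdel : Summable deltaSeq := (hasSum_ite_eq (0:ℤ) (1:ℝ)).summable
  have hV : Summable V := by simpa using hsd.add hdel
  have hV4 : Summable (fun k => V k ^ 4) := by
    refine Summable.of_norm_bounded (g := fun k => 8 * |V k|) (hV.abs.mul_left 8) fun k => ?_
    have h2 : |V k| ≤ 2 := by
      rcases k with j | j
      · rcases j with _ | j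
        · change |a 0| ≤ 2
          have := abs_le.1 h0
          rw [abs_le]; constructor <;> linarith
        · change |a (j + 1)| ≤ 2
          have h3 : σ ^ (j + 1) ≤ 1 := pow_le_one₀ hσ0.le (by linarith)
          have h4 : τ * σ ^ (j + 1) ≤ τ := mul_le_of_le_one_right hτ0.le h3
          linarith [hr j]
      · rw [Vs, abs_mul]
        have h3 : σ ^ j ≤ 1 := pow_le_one₀ hσ0.le (by linarith)
        have h4 : |x| ≤ 1 := by nlinarith
        have := mul_le_mul h4 ((hl j).trans (by linarith : 2 * σ ^ j ≤ 2)) (abs_nonneg _) zero_le_one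
        linarith
    rw [norm_pow, Real.norm_eq_abs]
    have h3 : |V k| ^ 3 ≤ 2 ^ 3 := pow_le_pow_left₀ (abs_nonneg _) h2 3
    calc |V k| ^ 4 = |V k| ^ 3 * |V k| := by ring
      _ ≤ 8 * |V k| := mul_le_mul_of_nonneg_right (by linarith) (abs_nonneg _)
  let S : ℤ → ℝ := fun n => ∑' k : ℤ, if n ≤ k then V k ^ 4 else 0
  have hS : ∀ n, S n = V n ^ 4 + S (n + 1) := fun n => gauge_step _ hV4 n
  have hSn : ∀ m : ℕ, S m = ∑' i, a (m + i) ^ 4 := fun m => gauge_nat (fun k => V k ^ 4) m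
  have hS0 : S 0 = a 0 ^ 4 + ∑' i, a (1 + i) ^ 4 := by
    have h1 := hS 0
    have h2 := hSn 1
    rw [zero_add] at h1
    rw [h1]; rw [Nat.cast_one] at h2; rw [h2]
  have hSl : ∀ j : ℕ, S (Int.negSucc j) = x ^ 4 * (∑ i ∈ Finset.range (j + 1), l i ^ 4) + S 0 := by
    intro j
    induction j with
    | zero =>
      rw [hS, Vs]; simp [mul_pow]
    | succ j ih =>
      rw [hS, Vs, show Int.negSucc (j + 1) + 1 = Int.negSucc j by omega, ih,
        Finset.sum_range_succ (n := j + 1)]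
      ring
  have ha0 : a 0 ≠ 0 := by
    have := abs_le.1 h0
    intro h; rw [h] at this; linarith [this.1]
  set Q := (a 1 + x * l 0) * (a 0)⁻¹ with hQ
  have hQa : Q * a 0 = a 1 + x * l 0 := by rw [hQ, mul_assoc, inv_mul_cancel₀ ha0, mul_one]
  have hS0' : S 0 = 1 + ε + 2 * μ - ε * |a 0| ^ q - μ * Q := by
    rw [hS0]; linear_combination 4 * e0
  have hxa : ∀ j, |x * l j| ^ q = |x| ^ q * |l j| ^ q := fun j => by
    rw [abs_mul, Real.mul_rpow (abs_nonneg _) (abs_nonneg _)]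
  have hb1 : 4 * b - 1 ≠ 0 := by intro h; linarith
  refine ⟨V, hV.abs, ?_, ?_⟩
  · intro n
    change μ * (V (n + 1) - 2 * V n + V (n - 1)) - (1 + ε) * V n + S n * V n + ε * |V n| ^ q * V n = 0
    rcases n with j | j
    · rcases j with _ | j
      · have v0 : V (Int.ofNat 0) = a 0 := rfl
        have v1 : V (Int.ofNat 0 + 1) = a 1 := rfl
        have v2 : V (Int.ofNat 0 - 1) = x * l 0 := rfl
        have s0 : S (Int.ofNat 0) = S 0 := rfl
        rw [v0, v1, v2, s0, hS0']
        linear_combination (-μ) * hQa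
      · have v0 : V (Int.ofNat (j + 1)) = a (j + 1) := rfl
        have v1 : V (Int.ofNat (j + 1) + 1) = a (j + 2) := rfl
        have v2 : V (Int.ofNat (j + 1) - 1) = a j := by
          rw [show Int.ofNat (j + 1) - 1 = ((j : ℕ) : ℤ) by simp]
        have s0 : S (Int.ofNat (j + 1)) = ∑' i, a (j + 1 + i) ^ 4 := hSn (j + 1)
        rw [v0, v1, v2, s0]
        have h := er j
        have hDp : 1 + ε + 2 * μ ≠ 0 := by positivity
        have h' : (1 + ε + 2 * μ) * a (j + 1) = μ * (a (j + 2) + a j)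
          + (∑' i, a (j + 1 + i) ^ 4) * a (j + 1) + ε * (|a (j + 1)| ^ q * a (j + 1)) := by
          conv_lhs => rw [h]
          rw [← mul_assoc, mul_one_div, div_self hDp, one_mul]
        linear_combination -h'
    · rcases j with _ | j
      · have v0 : V (Int.negSucc 0) = x * l 0 := rfl
        have v1 : V (Int.negSucc 0 + 1) = a 0 := rfl
        have v2 : V (Int.negSucc 0 - 1) = x * l 1 := rfl
        rw [v0, v1, v2, hSl, hS0', hxa]
        simp only [zero_add, Finset.sum_range_one]
        have h' : (4 * b - 1) * (l 0 - 1) = -b * (10 * (l 0 - 1) ^ 2 + 10 * (l 0 - 1) ^ 3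
          + 5 * (l 0 - 1) ^ 4 + (l 0 - 1) ^ 5)
          - ((a 0 - 1) + x * l 1 - (1 + b) * ((|a 0| ^ q - 1) * l 0)
          - x * (Q * l 0) + ((1 + b) * |x| ^ q) * (|l 0| ^ q * l 0)) := by
          conv_lhs => rw [f0]
          field_simp
          ring
        linear_combination μ * h' + (l 0 ^ 5) * hxb
          + (l 0 * (|x| ^ q * |l 0| ^ q - |a 0| ^ q)) * hxe
      · have v0 : V (Int.negSucc (j + 1)) = x * l (j + 1) := rfl
        have v1 : V (Int.negSucc (j + 1) + 1) = x * l j := rfl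
        have v2 : V (Int.negSucc (j + 1) - 1) = x * l (j + 2) := rfl
        rw [v0, v1, v2, hSl, hS0', hxa, Finset.sum_range_succ']
        have h := fl j
        linear_combination (-μ) * h
          + (l (j + 1) * ((∑ i ∈ Finset.range (j + 1), l (i + 1) ^ 4) + l 0 ^ 4)) * hxb
          + (l (j + 1) * (|x| ^ q * |l (j + 1)| ^ q - |a 0| ^ q)) * hxe
  · have h1 := Summable.tsum_le_tsum hle hsd.abs hD.summable
    rw [hD.tsum_eq] at h1
    have := mul_le_mul_of_nonneg_left hg2 hτ0.le
    have := mul_le_mul_of_nonneg_left hg2 (abs_nonneg x)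
    linarith

theorem threshold (q C δ : ℝ) (hq : 0 < q) (hC : 1 ≤ C) (hδ : 0 < δ) :
    ∃ κ > 0, ∀ ε μ x : ℝ, 0 < ε → ε ≤ κ → 0 < μ → μ ≤ κ → μ + x ^ 5 = ε * x →
      x ^ 5 ≤ μ / 8 → -(C * μ) ≤ x ^ 5 →
    ∃ V : ℤ → ℝ, Summable (fun n => |V n|) ∧
      (∀ n : ℤ, μ * (V (n + 1) - 2 * V n + V (n - 1)) - (1 + ε) * V n
        + (∑' k : ℤ, if n ≤ k then V k ^ 4 else 0) * V n + ε * |V n| ^ q * V n = 0) ∧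
      (∑' n, |V n - deltaSeq n|) ≤ δ := by
  have hC0 : 0 < C := by linarith
  set cp : ℝ := q * (2 * 2 ^ q) with hcp
  set N : ℝ := (q + 1) * 2 ^ q with hN
  have hcp0 : 0 < cp := by positivity
  have hN0 : 0 < N := by positivity
  obtain ⟨σ, hσ0, hσ, hCσ⟩ : ∃ σ : ℝ, 0 < σ ∧ σ ≤ 1 / 100 ∧ C * σ ≤ 1 / 1000 := by
    refine ⟨1 / (1000 * C), by positivity, ?_, le_of_eq (by field_simp)⟩
    rw [div_le_div_iff₀ (by positivity) (by norm_num)]; linarith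
  obtain ⟨τ, hτ0, hτ, hτδ, hτ2⟩ : ∃ τ : ℝ, 0 < τ ∧ (C + 1) * (cp + 1) * τ ≤ σ / 1000 ∧
      τ ≤ δ / 4 ∧ τ ≤ 1 / 2 := by
    refine ⟨min (σ / 1000 / ((C + 1) * (cp + 1))) (min (δ / 4) (1 / 2)), by positivity, ?_,
      (min_le_right _ _).trans (min_le_left _ _), (min_le_right _ _).trans (min_le_right _ _)⟩
    rw [← le_div_iff₀' (by positivity)]
    exact min_le_left _ _
  obtain ⟨ξ, hξ0, h1, h2, h3⟩ : ∃ ξ : ℝ, 0 < ξ ∧ ξ ≤ σ ^ 2 / 10000 ∧ ξ ≤ δ / 8 ∧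
      (C + 1) * N * ξ ^ q ≤ σ / 100 := by
    refine ⟨min (σ ^ 2 / 10000) (min (δ / 8) ((σ / 100 / ((C + 1) * N)) ^ (1 / q))),
      by positivity, min_le_left _ _,
      (min_le_right _ _).trans (min_le_left _ _), ?_⟩
    rw [← le_div_iff₀' (by positivity)]
    refine (Real.rpow_le_rpow (by positivity)
      ((min_le_right _ _).trans (min_le_right _ _)) hq.le).trans (le_of_eq ?_)
    rw [← Real.rpow_mul (by positivity), one_div_mul_cancel hq.ne', Real.rpow_one]
  refine ⟨min (1 / 100 / N) (min (1 / 100 / cp) (min (τ * σ / 1000) (ξ ^ 5 / C))), by positivity, ?_⟩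
  intro ε μ x hε0 hε hμ0 hμ hx hx1 hx2
  simp only [le_min_iff] at hε hμ
  have hxξ : |x| ≤ ξ := by
    refine le_of_pow_le_pow_left₀ (n := 5) (by norm_num) hξ0.le ?_
    rw [← abs_pow]
    have h5 := hμ.2.2.2
    rw [le_div_iff₀ hC0] at h5
    have h6 : μ ≤ C * μ := le_mul_of_one_le_left hμ0.le hC
    rw [abs_le]; constructor <;> linarith
  obtain ⟨V, hV, hVe, hVs⟩ := normalized q C σ τ ε μ x (x ^ 5 / μ) hq hC hσ0 hσ hCσ hτ0 hτ hε0
    ((le_div_iff₀ hN0).1 hε.1) ((le_div_iff₀ hcp0).1 hε.2.1) hμ0 hμ.2.2.1 (hxξ.trans h1)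
    (le_trans (mul_le_mul_of_nonneg_left (Real.rpow_le_rpow (abs_nonneg _) hxξ hq.le)
      (by positivity)) h3)
    (by
      rw [abs_div, abs_of_pos hμ0, div_le_iff₀ hμ0, abs_le]
      have h6 : μ ≤ C * μ := le_mul_of_one_le_left hμ0.le hC
      constructor <;> linarith)
    (by rw [div_le_iff₀ hμ0]; linarith) (by field_simp)
    (by rw [← hx]; field_simp) hτ2
  exact ⟨V, hV, hVe, hVs.trans (by linarith)⟩

/-- the branch `x > 0`, used when `p < 8/5` -/
theorem root_pos (ε μ : ℝ) (hε : 0 < ε) (hμ : 0 < μ) (h : 256 * μ ^ 4 ≤ ε ^ 5) :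
    ∃ x : ℝ, μ + x ^ 5 = ε * x ∧ x ^ 5 ≤ μ / 8 ∧ 0 ≤ x ^ 5 := by
  have hz : 0 ≤ 2 * μ / ε := by positivity
  have h32 : (2 * μ / ε) ^ 5 ≤ μ / 8 := by
    rw [div_pow, div_le_iff₀ (by positivity)]
    nlinarith
  have hc : ContinuousOn (fun x : ℝ => μ + x ^ 5 - ε * x) (Icc 0 (2 * μ / ε)) := by fun_prop
  have := intermediate_value_Icc' hz hc
  obtain ⟨x, hx, hx0⟩ := this (show (0:ℝ) ∈ _ from ⟨by
    have : ε * (2 * μ / ε) = 2 * μ := by field_simp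
    rw [this]; linarith, by simp; exact hμ.le⟩)
  exact ⟨x, by simp only at hx0; linarith, (pow_le_pow_left₀ hx.1 hx.2 5).trans h32,
    pow_nonneg hx.1 5⟩

/-- the staggered branch `x < 0`, used when `8/5 ≤ p` -/
theorem root_neg (ε μ C : ℝ) (hε : 0 < ε) (hμ : 0 < μ) (h1 : ε + μ ≤ 1) (hC : 2 ≤ C)
    (h : 32 * ε ^ 5 ≤ C ^ 4 * μ ^ 4) :
    ∃ x : ℝ, μ + x ^ 5 = ε * x ∧ x ^ 5 ≤ μ / 8 ∧ -(C * μ) ≤ x ^ 5 := by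
  have hc : ContinuousOn (fun y : ℝ => y ^ 5 - ε * y - μ) (Icc 0 1) := by fun_prop
  obtain ⟨y, hy, hy0⟩ := intermediate_value_Icc zero_le_one hc
    (show (0:ℝ) ∈ _ from ⟨by simp; exact hμ.le, by simp; linarith⟩)
  simp only at hy0
  have hy5 : 0 ≤ y ^ 5 := pow_nonneg hy.1 5
  refine ⟨-y, by linarith [show (-y) ^ 5 = - y ^ 5 by ring], ?_, ?_⟩
  · rw [show (-y) ^ 5 = - y ^ 5 by ring]; linarith
  · rw [show (-y) ^ 5 = - y ^ 5 by ring, neg_le_neg_iff]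
    by_contra! hlt
    have h2 : 2 * μ < y ^ 5 := lt_of_le_of_lt (mul_le_mul_of_nonneg_right hC hμ.le) hlt
    have hypos : 0 < y := by
      rcases hy.1.eq_or_lt with h | h
      · rw [← h] at h2; norm_num at h2; linarith
      · exact h
    have h3 : y ^ 4 ≤ 2 * ε := by
      have : y ^ 4 * y ≤ 2 * ε * y := by
        have : y ^ 4 * y = y ^ 5 := by ring
        linarith
      exact le_of_mul_le_mul_right this hypos
    have h4 : (y ^ 4) ^ 5 ≤ (2 * ε) ^ 5 := pow_le_pow_left₀ (by positivity) h3 5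
    have h5 : (C * μ) ^ 4 < (y ^ 5) ^ 4 := pow_lt_pow_left₀ hlt (by positivity) (by norm_num)
    have h6 : (y ^ 5) ^ 4 = (y ^ 4) ^ 5 := by ring
    have h7 : (2 * ε) ^ 5 = 32 * ε ^ 5 := by ring
    have h8 : (C * μ) ^ 4 = C ^ 4 * μ ^ 4 := by ring
    linarith

theorem tendsto_U (Ω : ℝ) (u : ℝ → ℝ) (hu : ∀ h, 0 < h → 0 < u h ∧ h ^ 2 / 4 * u h ^ 4 ≤ Ω) :
    Tendsto u atTop (𝓝 0) := by
  have h4 : Tendsto (fun h : ℝ => 4 * Ω / h ^ 2) atTop (𝓝 0) :=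
    tendsto_const_nhds.div_atTop (tendsto_pow_atTop (by norm_num))
  rw [Metric.tendsto_nhds]
  intro η hη
  filter_upwards [h4.eventually (gt_mem_nhds (show 0 < η ^ 4 by positivity)), eventually_gt_atTop 0]
    with h h1 h0
  obtain ⟨a, b⟩ := hu h h0
  rw [Real.dist_eq, sub_zero, abs_of_pos a]
  refine lt_of_pow_lt_pow_left₀ 4 hη.le (lt_of_le_of_lt ?_ h1)
  rw [le_div_iff₀ (by positivity)]
  linarith

theorem roots_exist (lam Ω q : ℝ) (hlam : 0 < lam) (hΩ : 0 < Ω) (hq : 0 < q) (u : ℝ → ℝ)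
    (hu : ∀ h : ℝ, 0 < h → 0 < u h ∧ lam * u h ^ q + h ^ 2 / 4 * u h ^ 4 = Ω) :
    ∃ C ≥ (1:ℝ), ∀ κ > (0:ℝ), ∀ᶠ h in atTop, 0 < h ∧ ∃ ε μ x : ℝ, 0 < ε ∧ ε ≤ κ ∧ 0 < μ ∧ μ ≤ κ ∧
      μ + x ^ 5 = ε * x ∧ x ^ 5 ≤ μ / 8 ∧ -(C * μ) ≤ x ^ 5 ∧
      ε * (h ^ 2 / 4 * u h ^ 4) = lam * u h ^ q ∧ μ * (h ^ 2 / 4 * u h ^ 4) = 1 / h ^ 2 := by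
  have hu0 : Tendsto u atTop (𝓝 0) := tendsto_U Ω u fun h hh => ⟨(hu h hh).1, by
    have h1 := (hu h hh).2
    have h2 : 0 ≤ lam * u h ^ q := mul_nonneg hlam.le (Real.rpow_nonneg (hu h hh).1.le _)
    linarith⟩
  have hpw : ∀ r : ℝ, 0 < r → Tendsto (fun h => u h ^ r) atTop (𝓝 0) := fun r hr => by
    have := hu0.rpow_const (p := r) (Or.inr hr.le)
    rwa [Real.zero_rpow hr.ne'] at this
  have hlq : Tendsto (fun h => lam * u h ^ q) atTop (𝓝 0) := by
    simpa using (hpw q hq).const_mul lam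
  -- basic facts
  have basic : ∀ κ > (0:ℝ), ∀ᶠ h in atTop, 0 < h ∧ u h ≤ 1 ∧ ∃ B ε μ : ℝ, B = h ^ 2 / 4 * u h ^ 4 ∧
      Ω / 2 ≤ B ∧ B ≤ Ω ∧ 0 < ε ∧ ε ≤ κ ∧ 0 < μ ∧ μ ≤ κ ∧ ε * B = lam * u h ^ q ∧
      μ * B = 1 / h ^ 2 ∧ 4 * B ^ 2 * μ = u h ^ 4 := by
    intro κ hκ
    have h4 : Tendsto (fun h => u h ^ 4 / Ω ^ 2) atTop (𝓝 0) := by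
      simpa using (hu0.pow 4).div_const (Ω ^ 2)
    filter_upwards [eventually_gt_atTop 0, hu0.eventually (gt_mem_nhds one_pos),
      hlq.eventually (gt_mem_nhds (show 0 < Ω / 2 by positivity)),
      hlq.eventually (gt_mem_nhds (show 0 < κ * (Ω / 2) by positivity)),
      h4.eventually (gt_mem_nhds hκ)] with h h0 h1 h2 h3 h5
    obtain ⟨hup, hue⟩ := hu h h0
    have hlp : 0 < lam * u h ^ q := mul_pos hlam (Real.rpow_pos_of_pos hup _)
    set B := h ^ 2 / 4 * u h ^ 4 with hB
    have hB1 : Ω / 2 ≤ B := by linarith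
    have hB0 : 0 < B := by linarith
    have hh2 : 0 < h ^ 2 := by positivity
    have hrel : 4 * B ^ 2 * (1 / (h ^ 2 * B)) = u h ^ 4 := by
      have : 4 * B ^ 2 * (1 / (h ^ 2 * B)) = 4 * B / h ^ 2 := by field_simp
      rw [this, hB]; field_simp
    have hm0 : 0 < 1 / (h ^ 2 * B) := by positivity
    refine ⟨h0, h1.le, B, lam * u h ^ q / B, 1 / (h ^ 2 * B), rfl, hB1, by linarith, by positivity,
      ?_, by positivity, ?_, by field_simp, by field_simp, hrel⟩
    · rw [div_le_iff₀ hB0]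
      exact h3.le.trans (mul_le_mul_of_nonneg_left hB1 hκ.le)
    · refine le_trans ?_ h5.le
      rw [le_div_iff₀ (by positivity), ← hrel]
      have : Ω ^ 2 ≤ 4 * B ^ 2 := by nlinarith
      nlinarith [mul_le_mul_of_nonneg_right this hm0.le]
  have hu5 : ∀ y : ℝ, 0 < y → (y ^ q) ^ 5 = y ^ (5 * q) := fun y hy => by
    rw [← Real.rpow_natCast (y ^ q) 5, ← Real.rpow_mul hy.le]; norm_num; ring_nf
  rcases lt_or_ge (5 * q) 16 with hq5 | hq5
  · refine ⟨1, le_rfl, fun κ hκ => ?_⟩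
    have h16 := (hpw (16 - 5 * q) (by linarith)).eventually
      (gt_mem_nhds (show 0 < lam ^ 5 * (Ω / 2) ^ 3 by positivity))
    filter_upwards [basic κ hκ, h16] with h hb h16
    obtain ⟨h0, h1, B, ε, μ, hB, hB1, hB2, hε0, hε, hμ0, hμ, e1, e2, e3⟩ := hb
    have hup := (hu h h0).1
    have hB0 : 0 < B := by linarith
    have key : 256 * μ ^ 4 ≤ ε ^ 5 := by
      have k1 : u h ^ 16 = u h ^ (16 - 5 * q) * (u h ^ q) ^ 5 := by
        rw [hu5 _ hup, ← Real.rpow_add hup, ← Real.rpow_natCast]; norm_num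
      have k2 : (Ω / 2) ^ 3 ≤ B ^ 3 := pow_le_pow_left₀ (by positivity) hB1 3
      have k3 : 0 < (u h ^ q) ^ 5 := by positivity
      have k4 : u h ^ 16 ≤ lam ^ 5 * B ^ 3 * (u h ^ q) ^ 5 := by
        rw [k1]
        refine mul_le_mul_of_nonneg_right (h16.le.trans ?_) k3.le
        exact mul_le_mul_of_nonneg_left k2 (by positivity)
      have k5 : 256 * μ ^ 4 * B ^ 8 = u h ^ 16 := by
        calc 256 * μ ^ 4 * B ^ 8 = (4 * B ^ 2 * μ) ^ 4 := by ring
          _ = u h ^ 16 := by rw [e3]; ring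
      have k6 : ε ^ 5 * B ^ 8 = lam ^ 5 * B ^ 3 * (u h ^ q) ^ 5 := by
        calc ε ^ 5 * B ^ 8 = (ε * B) ^ 5 * B ^ 3 := by ring
          _ = _ := by rw [e1]; ring
      refine le_of_mul_le_mul_right ?_ (show 0 < B ^ 8 by positivity)
      rw [k5, k6]; exact k4
    obtain ⟨x, hx1, hx2, hx3⟩ := root_pos ε μ hε0 hμ0 key
    exact ⟨h0, ε, μ, x, hε0, hε, hμ0, hμ, hx1, hx2, by linarith, hB ▸ e1, hB ▸ e2⟩
  · set C := 2 + 8192 * lam ^ 5 * Ω ^ 3 with hC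
    have hCp : 0 < 8192 * lam ^ 5 * Ω ^ 3 := by positivity
    refine ⟨C, by linarith, fun κ hκ => ?_⟩
    filter_upwards [basic (min κ (1 / 2)) (by positivity)] with h hb
    obtain ⟨h0, h1, B, ε, μ, hB, hB1, hB2, hε0, hε, hμ0, hμ, e1, e2, e3⟩ := hb
    rw [le_min_iff] at hε hμ
    have hup := (hu h h0).1
    have hB0 : 0 < B := by linarith
    have key : 32 * ε ^ 5 ≤ C ^ 4 * μ ^ 4 := by
      have k1 : (u h ^ q) ^ 5 ≤ u h ^ 16 := by
        rw [hu5 _ hup, ← Real.rpow_natCast]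
        exact Real.rpow_le_rpow_of_exponent_ge hup h1 (by norm_num; exact hq5)
      have k2 : B ^ 3 ≤ Ω ^ 3 := pow_le_pow_left₀ hB0.le hB2 3
      have k3 : 0 < (u h ^ q) ^ 5 := by positivity
      have k5 : 256 * μ ^ 4 * B ^ 8 = u h ^ 16 := by
        calc 256 * μ ^ 4 * B ^ 8 = (4 * B ^ 2 * μ) ^ 4 := by ring
          _ = u h ^ 16 := by rw [e3]; ring
      have k6 : ε ^ 5 * B ^ 8 = lam ^ 5 * B ^ 3 * (u h ^ q) ^ 5 := by
        calc ε ^ 5 * B ^ 8 = (ε * B) ^ 5 * B ^ 3 := by ring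
          _ = _ := by rw [e1]; ring
      have k7 : C ≤ C ^ 4 := le_self_pow₀ (by linarith) (by norm_num)
      have k8 : 8192 * lam ^ 5 * B ^ 3 ≤ C ^ 4 := by
        have := mul_le_mul_of_nonneg_left k2 (show 0 ≤ 8192 * lam ^ 5 by positivity)
        linarith
      have k9 := mul_le_mul k8 k1 k3.le (by positivity)
      refine le_of_mul_le_mul_right ?_ (show 0 < B ^ 8 by positivity)
      have : C ^ 4 * μ ^ 4 * B ^ 8 = C ^ 4 * u h ^ 16 / 256 := by rw [← k5]; ring
      have : 32 * ε ^ 5 * B ^ 8 = 32 * (lam ^ 5 * B ^ 3 * (u h ^ q) ^ 5) := by rw [← k6]; ring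
      linarith
    obtain ⟨x, hx1, hx2, hx3⟩ := root_neg ε μ C hε0 hμ0 (by linarith) (by linarith) key
    exact ⟨h0, ε, μ, x, hε0, hε.1, hμ0, hμ.1, hx1, hx2, hx3, hB ▸ e1, hB ▸ e2⟩

theorem gauge_bound (V : ℤ → ℝ) (hV : Summable (fun n => |V n|)) (δ : ℝ) (hδ1 : δ ≤ 1)
    (hs : (∑' n, |V n - deltaSeq n|) ≤ δ) (n : ℤ) :
    |(∑' k : ℤ, if n ≤ k then V k ^ 4 else 0) - stepSeq n| ≤ 15 * δ := by
  have hdel : Summable deltaSeq := (hasSum_ite_eq (0:ℤ) (1:ℝ)).summable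
  have hsd : Summable (fun n => |V n - deltaSeq n|) := (hV.of_abs.sub hdel).abs
  have hle1 : ∀ k, |V k - deltaSeq k| ≤ 1 := fun k =>
    (hsd.le_tsum k fun _ _ => abs_nonneg _).trans (hs.trans hδ1)
  have hstep : stepSeq n = ∑' k : ℤ, if n ≤ k then deltaSeq k else 0 := by
    have : (fun k : ℤ => if n ≤ k then deltaSeq k else 0)
        = fun k => if k = 0 then stepSeq n else 0 := by
      ext k
      by_cases hk : k = 0
      · subst hk; simp [deltaSeq, stepSeq]
      · simp [deltaSeq, hk]
    rw [this, tsum_ite_eq]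
  have hpt : ∀ k, |(V k ^ 4 - deltaSeq k)| ≤ 15 * |V k - deltaSeq k| := fun k => by
    have h1 := hle1 k
    have hd : deltaSeq k = 0 ∨ deltaSeq k = 1 := by
      by_cases hk : k = 0 <;> simp [deltaSeq, hk]
    have h4 : V k ^ 4 - deltaSeq k
        = (V k - deltaSeq k) * ((V k + deltaSeq k) * (V k ^ 2 + deltaSeq k)) := by
      rcases hd with h | h <;> rw [h] <;> ring
    rw [h4, abs_mul, mul_comm]
    refine mul_le_mul_of_nonneg_right ?_ (abs_nonneg _)
    have h5 : |V k| ≤ 2 := by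
      rw [abs_le] at h1 ⊢
      rcases hd with h | h <;> rw [h] at h1 <;> constructor <;> linarith [h1.1, h1.2]
    have hd0 : 0 ≤ deltaSeq k ∧ deltaSeq k ≤ 1 := by rcases hd with h | h <;> rw [h] <;> norm_num
    have h6 : |V k + deltaSeq k| ≤ 3 := by
      rw [abs_le] at h5 ⊢; constructor <;> linarith [h5.1, h5.2, hd0.1, hd0.2]
    have h7 : |V k ^ 2 + deltaSeq k| ≤ 5 := by
      rw [abs_of_nonneg (by nlinarith)]
      have : V k ^ 2 ≤ 2 ^ 2 := by rw [← sq_abs]; exact pow_le_pow_left₀ (abs_nonneg _) h5 2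
      linarith
    rw [abs_mul]
    have := mul_le_mul h6 h7 (abs_nonneg _) (by norm_num)
    linarith
  have hs4 : Summable (fun k => V k ^ 4 - deltaSeq k) :=
    Summable.of_norm_bounded (hsd.mul_left 15) hpt
  have hV4 : Summable (fun k => V k ^ 4) := by simpa using hs4.add hdel
  have hite : ∀ F : ℤ → ℝ, Summable F → Summable (fun k => if n ≤ k then F k else 0) :=
    fun F hF => by
      refine (hF.indicator {k : ℤ | n ≤ k}).congr fun k => ?_
      simp [Set.indicator]
  rw [hstep, ← Summable.tsum_sub (hite _ hV4) (hite _ hdel)]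
  have hpt2 : ∀ k, ‖(if n ≤ k then V k ^ 4 else 0) - (if n ≤ k then deltaSeq k else 0)‖
      ≤ 15 * |V k - deltaSeq k| := fun k => by
    rw [Real.norm_eq_abs]
    by_cases hk : n ≤ k
    · rw [if_pos hk, if_pos hk]; exact hpt k
    · rw [if_neg hk, if_neg hk, sub_zero, abs_zero]; positivity
  have hb := tsum_of_norm_bounded (hsd.mul_left 15).hasSum hpt2
  rw [Real.norm_eq_abs, tsum_mul_left] at hb
  linarith
/-- **Existence of single-site stationary bound states in the anti-continuum limit**
`h → ∞` for sub-quintic nonlinearity `p ∈ (0,2)`: for every `δ > 0` and all large `h`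
there is an `ℓ¹` solution `U` of the stationary system with gauge field
`Gₙ = (h²/4)Σ_{k≥n} U_k⁴` such that `U ≈ 𝒰(h)δ₀` and `G ≈ (h²/4)𝒰(h)⁴χ₀`. -/
theorem single_site_anticontinuum_existence
    (lam Ω p : ℝ) (hlam : 0 < lam) (hΩ : 0 < Ω) (hp : 0 < p) (hp2 : p < 2)
    (𝒰 : ℝ → ℝ)
    (h𝒰 : ∀ h : ℝ, 0 < h →
      0 < 𝒰 h ∧ lam * 𝒰 h ^ (2 * p) + h ^ 2 / 4 * 𝒰 h ^ 4 = Ω) :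
    ∀ δ : ℝ, 0 < δ → ∃ h₀ > (0 : ℝ), ∀ h : ℝ, h₀ ≤ h →
      ∃ U : ℤ → ℝ,
        Summable (fun n => |U n|)
        ∧ (∀ n : ℤ,
            (1 / h ^ 2) * (U (n + 1) - 2 * U n + U (n - 1)) - Ω * U n
              + (h ^ 2 / 4 * ∑' k : ℤ, (if n ≤ k then (U k) ^ 4 else 0)) * U n
              + lam * |U n| ^ (2 * p) * U n = 0)
        ∧ (∑' n : ℤ, |U n - 𝒰 h * deltaSeq n|) ≤ δ * 𝒰 h
        ∧ ∀ n : ℤ,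
            |(h ^ 2 / 4 * ∑' k : ℤ, (if n ≤ k then (U k) ^ 4 else 0))
                - h ^ 2 / 4 * 𝒰 h ^ 4 * stepSeq n|
              ≤ δ * h ^ 2 * 𝒰 h ^ 4 := by
  intro δ hδ
  obtain ⟨C, hC, hroots⟩ := roots_exist lam Ω (2 * p) hlam hΩ (by linarith) 𝒰 h𝒰
  have hδ' : 0 < min (δ / 4) 1 := by positivity
  obtain ⟨κ, hκ, hth⟩ := threshold (2 * p) C (min (δ / 4) 1) (by linarith) hC hδ'
  obtain ⟨h₁, hh₁⟩ := eventually_atTop.1 (hroots κ hκ)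
  refine ⟨max h₁ 1, by positivity, fun h hh => ?_⟩
  obtain ⟨h0, ε, μ, x, hε0, hε, hμ0, hμ, hx1, hx2, hx3, e1, e2⟩ := hh₁ h ((le_max_left _ _).trans hh)
  obtain ⟨V, hV, hVe, hVs⟩ := hth ε μ x hε0 hε hμ0 hμ hx1 hx2 hx3
  obtain ⟨hup, hue⟩ := h𝒰 h h0
  set u := 𝒰 h with hu
  have hsum : ∀ n : ℤ, (∑' k : ℤ, (if n ≤ k then (u * V k) ^ 4 else 0))
      = u ^ 4 * ∑' k : ℤ, (if n ≤ k then V k ^ 4 else 0) := fun n => by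
    rw [← tsum_mul_left]
    refine tsum_congr fun k => ?_
    split_ifs <;> ring
  refine ⟨fun n => u * V n, ?_, fun n => ?_, ?_, fun n => ?_⟩
  · simpa [abs_mul] using hV.mul_left |u|
  · have h1 := hVe n
    have h2 : |u * V n| ^ (2 * p) = u ^ (2 * p) * |V n| ^ (2 * p) := by
      rw [abs_mul, abs_of_pos hup, Real.mul_rpow hup.le (abs_nonneg _)]
    simp only [hsum, h2]
    rw [← e2, ← hue, ← mul_assoc lam, ← e1]
    linear_combination (h ^ 2 / 4 * u ^ 4 * u) * h1
  · have : ∀ n, |u * V n - u * deltaSeq n| = u * |V n - deltaSeq n| := fun n => by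
      rw [← mul_sub, abs_mul, abs_of_pos hup]
    simp only [this]
    rw [tsum_mul_left, mul_comm δ]
    refine mul_le_mul_of_nonneg_left (hVs.trans ((min_le_left _ _).trans ?_)) hup.le
    linarith
  · simp only [hsum]
    have h1 := gauge_bound V hV _ (min_le_right _ _) hVs n
    have h2 : min (δ / 4) 1 ≤ δ / 4 := min_le_left _ _
    have hBp : 0 ≤ h ^ 2 / 4 * u ^ 4 := by positivity
    rw [← mul_assoc, ← mul_sub, abs_mul, abs_of_nonneg hBp]
    have h3 := mul_le_mul_of_nonneg_left (h1.trans (by linarith : _ ≤ 4 * δ)) hBp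
    linarith
end

section
/- Fix λ > 0, Ω > 0, p > 0 and h > 0. Let U ∈ ℓ¹(ℤ) be a real sequence satisfying, for all n ∈ ℤ, (1/h²)(U_{n+1} − 2U_n + U_{n−1}) − Ω U_n + G_n U_n + λ |U_n|^{2p} U_n = 0, where G_n = (h²/4)·Σ_{k=n}^{∞} U_k⁴. Then (h²/4)·Σ_{n∈ℤ} U_n⁵ U_{n+1} + λ·Σ_{n∈ℤ} U_{n+1} U_n ( |U_n|^{2p} − |U_{n+1}|^{2p} ) = 0, where both series converge absolutely. -/
/-- **The solvability constraint**: multiplying the stationary discrete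
Chern–Simons–Schrödinger equation by `U_{n+1} − U_{n−1}` and summing over `ℤ` yields
`(h²/4)Σₙ Uₙ⁵U_{n+1} + λΣₙ U_{n+1}Uₙ(|Uₙ|^{2p} − |U_{n+1}|^{2p}) = 0`,
with both series converging absolutely. -/
theorem stationary_CSS_solvability_constraint
    (lam Ω p h : ℝ) (hlam : 0 < lam) (hΩ : 0 < Ω) (hp : 0 < p) (hh : 0 < h)
    (U : ℤ → ℝ) (hU : Summable (fun n => |U n|))
    (heq : ∀ n : ℤ,
      (1 / h ^ 2) * (U (n + 1) - 2 * U n + U (n - 1)) - Ω * U n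
        + (h ^ 2 / 4 * ∑' k : ℤ, (if n ≤ k then (U k) ^ 4 else 0)) * U n
        + lam * |U n| ^ (2 * p) * U n = 0) :
    Summable (fun n : ℤ => |U n ^ 5 * U (n + 1)|)
    ∧ Summable (fun n : ℤ => |U (n + 1) * U n * (|U n| ^ (2 * p) - |U (n + 1)| ^ (2 * p))|)
    ∧ h ^ 2 / 4 * (∑' n : ℤ, U n ^ 5 * U (n + 1))
        + lam * (∑' n : ℤ, U (n + 1) * U n * (|U n| ^ (2 * p) - |U (n + 1)| ^ (2 * p))) = 0 := by
  have hUs : Summable U := hU.of_abs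
  obtain ⟨M, hM0, hM⟩ : ∃ M : ℝ, 0 ≤ M ∧ ∀ n, |U n| ≤ M :=
    ⟨∑' n, |U n|, tsum_nonneg (fun _ => abs_nonneg _),
      fun n => hU.le_tsum n (fun _ _ => abs_nonneg _)⟩
  have key : ∀ (B : ℤ → ℝ) (C : ℝ), (∀ n, |B n| ≤ C) → ∀ W : ℤ → ℝ, Summable (fun n => |W n|) →
      Summable (fun n => |B n * W n|) := by
    intro B C hB W hW
    refine Summable.of_nonneg_of_le (fun _ => abs_nonneg _) (fun n => ?_) (hW.mul_left C)
    rw [abs_mul]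
    exact mul_le_mul_of_nonneg_right (hB n) (abs_nonneg _)
  have hP : Summable (fun n : ℤ => |U (n + 1) * U n|) :=
    key (fun n => U (n + 1)) M (fun n => hM _) U hU
  have hS : Summable (fun n : ℤ => |U n * U n|) := key U M hM U hU
  have hV : ∀ n, |(|U n| ^ (2 * p))| ≤ M ^ (2 * p) := by
    intro n
    rw [abs_of_nonneg (by positivity)]
    exact Real.rpow_le_rpow (abs_nonneg _) (hM n) (by positivity)
  have h4b : ∀ n, |U n ^ 4| ≤ M ^ 4 := by
    intro n
    rw [abs_pow]
    exact pow_le_pow_left₀ (abs_nonneg _) (hM n) 4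
  have h3b : ∀ n, |U n ^ 3| ≤ M ^ 3 := by
    intro n
    rw [abs_pow]
    exact pow_le_pow_left₀ (abs_nonneg _) (hM n) 3
  have h4 : Summable (fun n => U n ^ 4) := by
    have := (key (fun n => U n ^ 3) (M ^ 3) h3b U hU).of_abs
    refine this.congr (fun n => by ring)
  have hti : ∀ n : ℤ, Summable (fun k : ℤ => if n ≤ k then (U k) ^ 4 else 0) := by
    intro n
    refine Summable.of_nonneg_of_le (fun k => ?_) (fun k => ?_) h4
    · split_ifs <;> positivity
    · split_ifs
      · exact le_rfl
      · positivity
  obtain ⟨G, hG⟩ : ∃ G : ℤ → ℝ, G = fun n => ∑' k : ℤ, (if n ≤ k then (U k) ^ 4 else 0) := ⟨_, rfl⟩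
  have hGb : ∀ n, |G n| ≤ ∑' k, U k ^ 4 := by
    intro n
    rw [hG, abs_of_nonneg (tsum_nonneg (fun k => by split_ifs <;> positivity))]
    refine (hti n).tsum_le_tsum (fun k => ?_) h4
    split_ifs
    · exact le_rfl
    · positivity
  have hGd : ∀ n, G n = U n ^ 4 + G (n + 1) := by
    intro n
    have h1 : HasSum (fun k : ℤ => if k = n then U n ^ 4 else 0) (U n ^ 4) := hasSum_ite_eq n _
    have h2 := h1.add (hti (n + 1)).hasSum
    have h3 : (fun k : ℤ => (if k = n then U n ^ 4 else 0) + (if n + 1 ≤ k then (U k) ^ 4 else 0))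
        = fun k : ℤ => if n ≤ k then (U k) ^ 4 else 0 := by
      funext k
      rcases lt_trichotomy k n with hk | hk | hk
      · rw [if_neg (by omega), if_neg (by omega), if_neg (by omega)]; simp
      · subst hk; simp
      · rw [if_neg (by omega), if_pos (by omega), if_pos (by omega)]; simp
    rw [h3] at h2
    rw [hG]
    exact h2.tsum_eq
  have hA : Summable (fun n : ℤ => |U n ^ 5 * U (n + 1)|) :=
    (key (fun n => U n ^ 4) _ h4b _ hP).congr (fun n => by congr 1; ring)
  have hB : Summable
      (fun n : ℤ => |U (n + 1) * U n * (|U n| ^ (2 * p) - |U (n + 1)| ^ (2 * p))|) := by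
    refine (key (fun n => |U n| ^ (2 * p) - |U (n + 1)| ^ (2 * p))
      (M ^ (2 * p) + M ^ (2 * p)) (fun n => ?_) _ hP).congr (fun n => by congr 1; ring)
    exact (abs_sub _ _).trans (add_le_add (hV _) (hV _))
  refine ⟨hA, hB, ?_⟩
  obtain ⟨F, hF⟩ : ∃ F : ℤ → ℝ, F = fun n => (1 / h ^ 2) * (U (n + 1) * U (n + 1) + U n * U n)
      - (2 / h ^ 2 + Ω) * (U (n + 1) * U n) + h ^ 2 / 4 * (G n * (U (n + 1) * U n))
      + lam * (|U n| ^ (2 * p) * (U (n + 1) * U n)) := ⟨_, rfl⟩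
  have hFs : Summable F := by
    rw [hF]
    have s1 : Summable (fun n : ℤ => U (n + 1) * U (n + 1)) :=
      (Equiv.addRight (1 : ℤ)).summable_iff.mpr hS.of_abs
    exact ((((s1.add hS.of_abs).mul_left _).sub (hP.of_abs.mul_left _)).add
      ((key G _ hGb _ hP).of_abs.mul_left _)).add ((key _ _ hV _ hP).of_abs.mul_left _)
  have hFs1 : Summable (fun n : ℤ => F (n + 1)) :=
    (Equiv.addRight (1 : ℤ)).summable_iff.mpr hFs
  have hFt : ∑' n : ℤ, F (n + 1) = ∑' n, F n := (Equiv.addRight (1 : ℤ)).tsum_eq F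
  rw [← tsum_mul_left, ← tsum_mul_left, ← (hA.of_abs.mul_left _).tsum_add (hB.of_abs.mul_left _)]
  have hpt : ∀ n : ℤ, h ^ 2 / 4 * (U n ^ 5 * U (n + 1))
      + lam * (U (n + 1) * U n * (|U n| ^ (2 * p) - |U (n + 1)| ^ (2 * p))) = F n - F (n + 1) := by
    intro n
    have e := heq (n + 1)
    have eG : ∑' k : ℤ, (if n + 1 ≤ k then (U k) ^ 4 else 0) = G (n + 1) := by rw [hG]
    rw [eG, add_sub_cancel_right] at e
    have hd := hGd n
    simp only [hF]
    rw [hd]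
    linear_combination (U (n + 1 + 1) - U n) * e
  rw [tsum_congr hpt, hFs.tsum_sub hFs1, hFt, sub_self]
end
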